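/- arXiv:2407.15579 — 2 statements merged into one kernel-verified Lean document; each statement's English description precedes it below -/
import Mathlib

section
/- Let V, W be linearly independent Orlicz functions with limsup condition as in Cramér's bound, let (t_n, s_n) ∈ ℝ² with |t_n| ≥ |s_n| for all n and |t_n| → ∞. Then there exist ε ∈ (0,1) and a sequence δ_n → 0 such that for all n, |(1/Z_{α,β}) ∫_ℝ e^{αV(x)+βW(x)} e^{i t_n V(x) + i s_n W(x)} dx| ≤ 1 − ε + δ_n. -/
open MeasureTheory Filter Real

/-- Integration by parts against a phase `f`: the basic non-stationary phase estimate. -/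
theorem abs_mul_norm_integral_mul_deriv_mul_cexp_le {a b : ℝ} (hab : a ≤ b) {f f' h h' : ℝ → ℝ}
    (hf : ∀ x ∈ Set.Icc a b, HasDerivAt f (f' x) x)
    (hh : ∀ x ∈ Set.Icc a b, HasDerivAt h (h' x) x)
    (hf' : ContinuousOn f' (Set.Icc a b)) (hh' : ContinuousOn h' (Set.Icc a b))
    {H H' : ℝ} (hH : ∀ x ∈ Set.Icc a b, |h x| ≤ H) (hH' : ∀ x ∈ Set.Icc a b, |h' x| ≤ H')
    (t : ℝ) :
    |t| * ‖∫ x in a..b, ((h x * f' x : ℝ) : ℂ) * Complex.exp (Complex.I * (t * f x : ℝ))‖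
      ≤ 2 * H + H' * (b - a) := by
  have hnorm : ∀ x, ‖Complex.exp (Complex.I * (t * f x : ℝ))‖ = 1 := fun x => by
    rw [mul_comm, Complex.norm_exp_ofReal_mul_I]
  have hexp : ∀ x ∈ Set.Icc a b, HasDerivAt
      (fun x => Complex.exp (Complex.I * (t * f x : ℝ)))
      (Complex.exp (Complex.I * (t * f x : ℝ)) * (Complex.I * (t * f' x : ℝ))) x := fun x hx =>
    ((((hf x hx).const_mul t).ofReal_comp).const_mul Complex.I).cexp
  have hfc : ContinuousOn f (Set.Icc a b) := fun x hx => (hf x hx).continuousAt.continuousWithinAt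
  rw [← Set.uIcc_of_le hab] at hf hh hf' hh' hexp hfc
  have hparts := intervalIntegral.integral_mul_deriv_eq_deriv_mul
    (fun x hx => (hh x hx).ofReal_comp) hexp
    (Complex.continuous_ofReal.comp_continuousOn hh').intervalIntegrable
    (ContinuousOn.intervalIntegrable (by
      have h1 : ContinuousOn (fun x => ((t * f x : ℝ) : ℂ)) (Set.uIcc a b) :=
        Complex.continuous_ofReal.comp_continuousOn (continuousOn_const.mul hfc)
      have h2 : ContinuousOn (fun x => ((t * f' x : ℝ) : ℂ)) (Set.uIcc a b) :=
        Complex.continuous_ofReal.comp_continuousOn (continuousOn_const.mul hf')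
      fun_prop))
  have hlhs : (∫ x in a..b, (h x : ℂ) *
        (Complex.exp (Complex.I * (t * f x : ℝ)) * (Complex.I * (t * f' x : ℝ))))
      = (Complex.I * t) *
        ∫ x in a..b, ((h x * f' x : ℝ) : ℂ) * Complex.exp (Complex.I * (t * f x : ℝ)) := by
    rw [← intervalIntegral.integral_const_mul]
    congr 1 with x
    push_cast
    ring
  rw [hlhs] at hparts
  have hnorms := congrArg norm hparts
  rw [norm_mul, norm_mul, Complex.norm_I, one_mul, Complex.norm_real, Real.norm_eq_abs] at hnorms
  rw [hnorms]
  have hb : ‖(h b : ℂ) * Complex.exp (Complex.I * (t * f b : ℝ))‖ ≤ H := by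
    rw [norm_mul, hnorm, mul_one, Complex.norm_real]
    exact hH b (Set.right_mem_Icc.2 hab)
  have ha : ‖(h a : ℂ) * Complex.exp (Complex.I * (t * f a : ℝ))‖ ≤ H := by
    rw [norm_mul, hnorm, mul_one, Complex.norm_real]
    exact hH a (Set.left_mem_Icc.2 hab)
  have hint : ‖∫ x in a..b, (h' x : ℂ) * Complex.exp (Complex.I * (t * f x : ℝ))‖
      ≤ H' * |b - a| := by
    refine intervalIntegral.norm_integral_le_of_norm_le_const fun x hx => ?_
    rw [norm_mul, hnorm, mul_one, Complex.norm_real]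
    rw [Set.uIoc_of_le hab] at hx
    exact hH' x (Set.Ioc_subset_Icc_self hx)
  rw [abs_of_nonneg (sub_nonneg.2 hab)] at hint
  refine (norm_sub_le _ _).trans ?_
  linarith [norm_sub_le ((h b : ℂ) * Complex.exp (Complex.I * (t * f b : ℝ)))
    ((h a : ℂ) * Complex.exp (Complex.I * (t * f a : ℝ)))]

/-- If `V + r W` is non-stationary at `x₀`, the oscillatory integrals with phases `V + r' W` decay
on an interval around `x₀`, uniformly for `r'` near `r`. -/
theorem exists_interval_abs_mul_norm_integral_cexp_le {V W : ℝ → ℝ} {U : Set ℝ} (hU : IsOpen U)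
    (hV : ContDiffOn ℝ 2 V U) (hW : ContDiffOn ℝ 2 W U) (α β : ℝ) {r x₀ : ℝ} (hx₀ : x₀ ∈ U)
    (hne : deriv V x₀ + r * deriv W x₀ ≠ 0) :
    ∃ a b : ℝ, a < b ∧ ∃ K ∈ nhds r, ∃ C : ℝ, ∀ r' ∈ K, ∀ t : ℝ,
      |t| * ‖∫ x in a..b, (Real.exp (α * V x + β * W x) : ℂ) *
        Complex.exp (Complex.I * (t * (V x + r' * W x) : ℝ))‖ ≤ C := by
  have hV1 : ContDiffOn ℝ 1 (deriv V) U := hV.deriv_of_isOpen hU (by norm_num)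
  have hW1 : ContDiffOn ℝ 1 (deriv W) U := hW.deriv_of_isOpen hU (by norm_num)
  have dV : ∀ x ∈ U, HasDerivAt V (deriv V x) x := fun x hx =>
    ((hV.differentiableOn (by norm_num)).differentiableAt (hU.mem_nhds hx)).hasDerivAt
  have dW : ∀ x ∈ U, HasDerivAt W (deriv W x) x := fun x hx =>
    ((hW.differentiableOn (by norm_num)).differentiableAt (hU.mem_nhds hx)).hasDerivAt
  have dV' : ∀ x ∈ U, HasDerivAt (deriv V) (deriv (deriv V) x) x := fun x hx =>
    ((hV1.differentiableOn (by norm_num)).differentiableAt (hU.mem_nhds hx)).hasDerivAt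
  have dW' : ∀ x ∈ U, HasDerivAt (deriv W) (deriv (deriv W) x) x := fun x hx =>
    ((hW1.differentiableOn (by norm_num)).differentiableAt (hU.mem_nhds hx)).hasDerivAt
  have cV := hV.continuousOn
  have cW := hW.continuousOn
  have cV' := hV1.continuousOn
  have cW' := hW1.continuousOn
  have cV'' : ContinuousOn (deriv (deriv V)) U := hV1.continuousOn_deriv_of_isOpen hU le_rfl
  have cW'' : ContinuousOn (deriv (deriv W)) U := hW1.continuousOn_deriv_of_isOpen hU le_rfl
  obtain ⟨η, hη, hball⟩ : ∃ η > 0, ∀ r' x, r' ∈ Metric.closedBall r η →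
      x ∈ Metric.closedBall x₀ η → x ∈ U ∧ deriv V x + r' * deriv W x ≠ 0 := by
    have hcont : ContinuousAt (fun p : ℝ × ℝ => deriv V p.2 + p.1 * deriv W p.2) (r, x₀) := by
      have h1 : ContinuousAt (fun p : ℝ × ℝ => deriv V p.2) (r, x₀) :=
        ContinuousAt.comp (f := Prod.snd) (cV'.continuousAt (hU.mem_nhds hx₀)) continuousAt_snd
      have h2 : ContinuousAt (fun p : ℝ × ℝ => deriv W p.2) (r, x₀) :=
        ContinuousAt.comp (f := Prod.snd) (cW'.continuousAt (hU.mem_nhds hx₀)) continuousAt_snd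
      fun_prop
    have hev : ∀ᶠ p : ℝ × ℝ in nhds (r, x₀), p.2 ∈ U ∧ deriv V p.2 + p.1 * deriv W p.2 ≠ 0 :=
      (continuousAt_snd.eventually (hU.mem_nhds hx₀)).and (hcont.eventually_ne hne)
    obtain ⟨η, hη, hsub⟩ := Metric.nhds_basis_closedBall.mem_iff.1 hev
    refine ⟨η, hη, fun r' x hr hx => @hsub (r', x) ?_⟩
    rw [← closedBall_prod_same]
    exact ⟨hr, hx⟩
  simp only [Real.closedBall_eq_Icc] at hball
  set K := Set.Icc (r - η) (r + η)
  set J := Set.Icc (x₀ - η) (x₀ + η)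
  let F : ℝ → ℝ → ℝ := fun r' x => deriv V x + r' * deriv W x
  let F' : ℝ → ℝ → ℝ := fun r' x => deriv (deriv V) x + r' * deriv (deriv W) x
  let E : ℝ → ℝ := fun x => Real.exp (α * V x + β * W x)
  let h : ℝ → ℝ → ℝ := fun r' x => E x / F r' x
  let h' : ℝ → ℝ → ℝ := fun r' x =>
    (E x * (α * deriv V x + β * deriv W x) * F r' x - E x * F' r' x) / F r' x ^ 2
  have hKJ : IsCompact (K ×ˢ J) := isCompact_Icc.prod isCompact_Icc
  have hsnd : ∀ {g : ℝ → ℝ}, ContinuousOn g U →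
      ContinuousOn (fun p : ℝ × ℝ => g p.2) (K ×ˢ J) := fun hg =>
    hg.comp continuousOn_snd fun p hp => (hball p.1 p.2 hp.1 hp.2).1
  have qV := hsnd cV
  have qW := hsnd cW
  have qV' := hsnd cV'
  have qW' := hsnd cW'
  have qV'' := hsnd cV''
  have qW'' := hsnd cW''
  have hFne : ∀ p ∈ K ×ˢ J, F p.1 p.2 ≠ 0 := fun p hp => (hball p.1 p.2 hp.1 hp.2).2
  have qE : ContinuousOn (fun p : ℝ × ℝ => E p.2) (K ×ˢ J) :=
    ((continuousOn_const.mul qV).add (continuousOn_const.mul qW)).rexp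
  have qF : ContinuousOn (fun p : ℝ × ℝ => F p.1 p.2) (K ×ˢ J) := by
    simp only [F]; fun_prop
  have qF' : ContinuousOn (fun p : ℝ × ℝ => F' p.1 p.2) (K ×ˢ J) := by
    simp only [F']; fun_prop
  have qh : ContinuousOn (fun p : ℝ × ℝ => h p.1 p.2) (K ×ˢ J) := qE.div qF hFne
  have qh' : ContinuousOn (fun p : ℝ × ℝ => h' p.1 p.2) (K ×ˢ J) :=
    ContinuousOn.div
      (((qE.mul ((continuousOn_const.mul qV').add (continuousOn_const.mul qW'))).mul qF).sub
        (qE.mul qF')) (qF.pow 2) fun p hp => pow_ne_zero 2 (hFne p hp)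
  obtain ⟨H, hH⟩ := hKJ.exists_bound_of_continuousOn qh
  obtain ⟨H', hH'⟩ := hKJ.exists_bound_of_continuousOn qh'
  refine ⟨x₀ - η, x₀ + η, by linarith, K, Icc_mem_nhds (by linarith) (by linarith),
    2 * H + H' * (x₀ + η - (x₀ - η)), fun r' hr' t => ?_⟩
  have hslice : ∀ {g : ℝ × ℝ → ℝ}, ContinuousOn g (K ×ˢ J) →
      ContinuousOn (fun x => g (r', x)) J := fun hg =>
    hg.comp (by fun_prop) fun x hx => ⟨hr', hx⟩
  have key := abs_mul_norm_integral_mul_deriv_mul_cexp_le (a := x₀ - η) (b := x₀ + η)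
    (by linarith) (f := fun x => V x + r' * W x) (f' := F r') (h := h r') (h' := h' r')
    (fun x hx => (dV x (hball r' x hr' hx).1).add ((dW x (hball r' x hr' hx).1).const_mul r'))
    (fun x hx => by
      have hxU := (hball r' x hr' hx).1
      have dE : HasDerivAt E (E x * (α * deriv V x + β * deriv W x)) x :=
        (((dV x hxU).const_mul α).add ((dW x hxU).const_mul β)).exp
      have dF : HasDerivAt (F r') (F' r' x) x :=
        (dV' x hxU).add ((dW' x hxU).const_mul r')
      exact dE.div dF (hball r' x hr' hx).2)
    (hslice qF) (hslice qh') (fun x hx => hH (r', x) ⟨hr', hx⟩)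
    (fun x hx => hH' (r', x) ⟨hr', hx⟩) t
  refine le_of_eq_of_le ?_ key
  congr 2
  refine intervalIntegral.integral_congr fun x hx => ?_
  rw [Set.uIcc_of_le (by linarith)] at hx
  have hF : F r' x ≠ 0 := (hball r' x hr' hx).2
  have : h r' x * F r' x = E x := div_mul_cancel₀ _ hF
  simp only [this, E]

/-- A continuous function which is differentiable off a countable set with zero derivative there is
constant. -/
theorem eq_of_hasDerivAt_zero_off_countable {f : ℝ → ℝ} (hf : Continuous f) {S : Set ℝ}
    (hS : S.Countable) (hd : ∀ x ∉ S, HasDerivAt f 0 x) (a b : ℝ) : f a = f b := by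
  have := integral_eq_of_hasDerivAt_off_countable f (fun _ => 0) hS
    (a := a) (b := b) hf.continuousOn (fun x hx => hd x hx.2) (by simp)
  simp only [intervalIntegral.integral_zero] at this
  linarith

/-- Decay of an oscillatory integral on one interval keeps the normalized full integral away from
`1`. -/
theorem exists_norm_integral_div_le {g : ℝ → ℝ}
    (hg : Integrable (fun x => Real.exp (g x))) {a b : ℝ} (hab : a < b) (C : ℝ) :
    ∃ ε ∈ Set.Ioo (0 : ℝ) 1, ∃ T : ℝ, ∀ t : ℝ, T ≤ |t| → ∀ f : ℝ → ℝ, Continuous f →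
      |t| * ‖∫ x in a..b, (Real.exp (g x) : ℂ) * Complex.exp (Complex.I * (f x : ℝ))‖ ≤ C →
      ‖(∫ x, (Real.exp (g x) : ℂ) * Complex.exp (Complex.I * (f x : ℝ))) /
        ((∫ x, Real.exp (g x) : ℝ) : ℂ)‖ ≤ 1 - ε := by
  set Z := ∫ x, Real.exp (g x)
  set m := ∫ x in Set.Ioc a b, Real.exp (g x)
  set m' := ∫ x in (Set.Ioc a b)ᶜ, Real.exp (g x)
  have hm : 0 < m := by
    have := intervalIntegral.intervalIntegral_pos_of_pos (hg.intervalIntegrable (a := a) (b := b))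
      (fun x => Real.exp_pos _) hab
    rwa [intervalIntegral.integral_of_le hab.le] at this
  have hm' : 0 ≤ m' := integral_nonneg fun x => (Real.exp_pos _).le
  have hsum : m + m' = Z := integral_add_compl measurableSet_Ioc hg
  have hZ : 0 < Z := by linarith
  refine ⟨m / (2 * Z), ⟨by positivity, ?_⟩, max 1 (2 * C / m), fun t ht f hf hC => ?_⟩
  · rw [div_lt_one (by positivity)]
    linarith
  have ht0 : 0 < |t| := lt_of_lt_of_le one_pos ((le_max_left _ _).trans ht)
  have htC : 2 * C ≤ |t| * m := (div_le_iff₀ hm).1 ((le_max_right _ _).trans ht)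
  have hnorm : ∀ x, ‖(Real.exp (g x) : ℂ) * Complex.exp (Complex.I * (f x : ℝ))‖
      = Real.exp (g x) := fun x => by
    rw [norm_mul, mul_comm Complex.I, Complex.norm_exp_ofReal_mul_I, mul_one, Complex.norm_real,
      Real.norm_of_nonneg (Real.exp_pos _).le]
  have hint : Integrable
      (fun x => (Real.exp (g x) : ℂ) * Complex.exp (Complex.I * (f x : ℝ))) := by
    refine Integrable.mono' hg ?_ (ae_of_all _ fun x => (hnorm x).le)
    exact hg.ofReal.aestronglyMeasurable.mul
      (by fun_prop : Continuous fun x => Complex.exp (Complex.I * (f x : ℝ))).aestronglyMeasurable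
  rw [intervalIntegral.integral_of_le hab.le] at hC
  have hin : ‖∫ x in Set.Ioc a b, (Real.exp (g x) : ℂ) * Complex.exp (Complex.I * (f x : ℝ))‖
      ≤ m / 2 := by
    refine le_of_mul_le_mul_left (hC.trans ?_) ht0
    linarith
  have hout : ‖∫ x in (Set.Ioc a b)ᶜ,
      (Real.exp (g x) : ℂ) * Complex.exp (Complex.I * (f x : ℝ))‖ ≤ m' :=
    (norm_integral_le_integral_norm _).trans (by simp only [hnorm]; exact le_rfl)
  rw [norm_div, Complex.norm_real, Real.norm_of_nonneg hZ.le, div_le_iff₀ hZ,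
    ← integral_add_compl (measurableSet_Ioc (a := a) (b := b)) hint]
  refine (norm_add_le _ _).trans ((add_le_add hin hout).trans (le_of_eq ?_))
  field_simp
  linarith

theorem gibbs_char_fct_sequence_bound
    (V W : ℝ → ℝ)
    (hVsym : ∀ x, V (-x) = V x) (hVconv : ConvexOn ℝ Set.univ V)
    (hVnonneg : ∀ x, 0 ≤ V x) (hVzero : ∀ x, V x = 0 ↔ x = 0)
    (hWsym : ∀ x, W (-x) = W x) (hWconv : ConvexOn ℝ Set.univ W)
    (hWnonneg : ∀ x, 0 ≤ W x) (hWzero : ∀ x, W x = 0 ↔ x = 0)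
    (S : Set ℝ) (hScount : S.Countable)
    (hSacc : ∀ x : ℝ, ¬ AccPt x (Filter.principal S))
    (hVC2 : ContDiffOn ℝ 2 V Sᶜ) (hWC2 : ContDiffOn ℝ 2 W Sᶜ)
    (hli : ∀ a b : ℝ, (∀ x, a * V x + b * W x = 0) → a = 0 ∧ b = 0)
    (α β : ℝ)
    (hZ : Integrable (fun x => Real.exp (α * V x + β * W x)))
    (t s : ℕ → ℝ)
    (hts : ∀ n, |s n| ≤ |t n|)
    (ht : Filter.Tendsto (fun n => |t n|) Filter.atTop Filter.atTop) :
    ∃ ε ∈ Set.Ioo (0 : ℝ) 1, ∃ δ : ℕ → ℝ,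
      Filter.Tendsto δ Filter.atTop (nhds 0) ∧
      ∀ n : ℕ,
        ‖(∫ x, (Real.exp (α * V x + β * W x) : ℂ) *
            Complex.exp (Complex.I * (t n * V x + s n * W x))) /
          ((∫ x, Real.exp (α * V x + β * W x) : ℝ) : ℂ)‖ ≤ 1 - ε + δ n := by
  have hVc : Continuous V := continuousOn_univ.1 (by simpa using hVconv.continuousOn_interior)
  have hWc : Continuous W := continuousOn_univ.1 (by simpa using hWconv.continuousOn_interior)
  have hU : IsOpen Sᶜ := by
    rw [isOpen_compl_iff, isClosed_iff_derivedSet_subset]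
    exact fun x hx => (hSacc x hx).elim
  let φ : ℝ → ℝ → ℝ := fun t r =>
    ‖(∫ x, (Real.exp (α * V x + β * W x) : ℂ) *
        Complex.exp (Complex.I * (t * (V x + r * W x) : ℝ))) /
      ((∫ x, Real.exp (α * V x + β * W x) : ℝ) : ℂ)‖
  have hlocal : ∀ r : ℝ, ∃ K ∈ nhds r, ∃ ε ∈ Set.Ioo (0 : ℝ) 1, ∃ T : ℝ,
      ∀ r' ∈ K, ∀ t, T ≤ |t| → φ t r' ≤ 1 - ε := by
    intro r
    obtain ⟨x₀, hx₀, hne⟩ : ∃ x₀ ∈ Sᶜ, deriv V x₀ + r * deriv W x₀ ≠ 0 := by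
      by_contra! hzero
      have hconst := eq_of_hasDerivAt_zero_off_countable (f := fun x => V x + r * W x)
        (by fun_prop) hScount (fun x hx => by
          rw [← hzero x hx]
          exact ((hVC2.differentiableOn (by norm_num)).differentiableAt
            (hU.mem_nhds hx)).hasDerivAt.add
            (((hWC2.differentiableOn (by norm_num)).differentiableAt
            (hU.mem_nhds hx)).hasDerivAt.const_mul r))
      refine one_ne_zero (hli 1 r fun x => ?_).1
      have := hconst x 0
      simp only [(hVzero 0).2 rfl, (hWzero 0).2 rfl] at this
      linarith
    obtain ⟨a, b, hab, K, hK, C, hC⟩ :=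
      exists_interval_abs_mul_norm_integral_cexp_le hU hVC2 hWC2 α β hx₀ hne
    obtain ⟨ε, hε, T, hT⟩ := exists_norm_integral_div_le hZ hab C
    exact ⟨K, hK, ε, hε, T, fun r' hr' t ht => hT t ht _ (by fun_prop) (hC r' hr' t)⟩
  obtain ⟨ε, hε, T, hT⟩ : ∃ ε ∈ Set.Ioo (0 : ℝ) 1, ∃ T : ℝ,
      ∀ r ∈ Set.Icc (-1 : ℝ) 1, ∀ t, T ≤ |t| → φ t r ≤ 1 - ε := by
    refine (isCompact_Icc (a := (-1 : ℝ)) (b := 1)).induction_on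
      (p := fun A => ∃ ε ∈ Set.Ioo (0 : ℝ) 1, ∃ T : ℝ, ∀ r ∈ A, ∀ t, T ≤ |t| → φ t r ≤ 1 - ε)
      ⟨1 / 2, by norm_num, 0, by simp⟩ ?_ ?_ ?_
    · rintro A B hAB ⟨ε, hε, T, hT⟩
      exact ⟨ε, hε, T, fun r hr => hT r (hAB hr)⟩
    · rintro A B ⟨ε, hε, T, hT⟩ ⟨ε', hε', T', hT'⟩
      refine ⟨min ε ε', ⟨lt_min hε.1 hε'.1, min_lt_of_left_lt hε.2⟩, max T T', ?_⟩
      rintro r (hr | hr) t ht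
      · linarith [hT r hr t ((le_max_left _ _).trans ht), min_le_left ε ε']
      · linarith [hT' r hr t ((le_max_right _ _).trans ht), min_le_right ε ε']
    · intro r _
      obtain ⟨K, hK, h⟩ := hlocal r
      exact ⟨K, mem_nhdsWithin_of_mem_nhds hK, h⟩
  refine ⟨ε, hε, fun n => max 0 (_ - (1 - ε)), ?_, fun n =>
    sub_le_iff_le_add'.1 (le_max_right _ _)⟩
  refine tendsto_const_nhds.congr' ?_
  filter_upwards [ht.eventually_ge_atTop (max 1 T)] with n hn
  have ht0 : 0 < |t n| := lt_of_lt_of_le one_pos ((le_max_left _ _).trans hn)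
  have hr : s n / t n ∈ Set.Icc (-1 : ℝ) 1 := by
    rw [Set.mem_Icc, ← abs_le, abs_div]
    exact div_le_one_of_le₀ (hts n) (abs_nonneg _)
  have hbound := hT _ hr (t n) ((le_max_right _ _).trans hn)
  refine (max_eq_left ?_).symm
  rw [sub_nonpos]
  refine le_of_eq_of_le ?_ hbound
  simp only [φ]
  congr 3 with x
  have : t n * (V x + s n / t n * W x) = t n * V x + s n * W x := by
    field_simp [abs_pos.1 ht0]
  rw [this]
  push_cast
  rfl
end

section
/- Let V be an Orlicz function, R > 0, and α* < 0 the unique real number with E_{μ_{α*}}[V(X)] = R, where μ_{α*} has density e^{α*V(x)}/Z_{α*}. With σ*² = Var_{μ_{α*}}[V(X)], the volume of the Orlicz ball B_R^{(n,V)} = {x ∈ ℝⁿ : Σ V(x_i) ≤ nR} satisfies vol_n(B_R^{(n,V)}) = e^{−α* nR} Z_{α*}^n / (√(2πn) σ* |α*|) · (1 + O(n^{−1/2})) as n → ∞. -/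
open MeasureTheory Filter Real

/-- The profile `(1 + |s| + |s|³) e^{-cs²}` dominating the rescaled error. -/
lemma integrable_one_add_abs_add_cube_mul_exp {c : ℝ} (hc : 0 < c) :
    Integrable fun s : ℝ ↦ (1 + |s| + |s| ^ 3) * Real.exp (-c * s ^ 2) := by
  have h0 := integrable_exp_neg_mul_sq hc
  have h1 := (integrable_mul_exp_neg_mul_sq hc).norm
  have h3 := (integrable_rpow_mul_exp_neg_mul_sq hc (s := 3) (by norm_num)).norm
  refine ((h0.add h1).add h3).congr (.of_forall fun s ↦ ?_)
  have : s ^ (3 : ℝ) = s ^ 3 := by exact_mod_cast Real.rpow_natCast s 3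
  simp only [Pi.add_apply, norm_mul, Real.norm_eq_abs, Real.abs_exp, this, abs_pow]
  ring

lemma norm_pow_sub_pow_le {a b : ℂ} {r : ℝ} (ha : ‖a‖ ≤ r) (hb : ‖b‖ ≤ r) (n : ℕ) :
    ‖a ^ n - b ^ n‖ ≤ n * r ^ (n - 1) * ‖a - b‖ := by
  rw [← (Commute.all a b).geom_sum₂_mul, norm_mul]
  refine mul_le_mul_of_nonneg_right ?_ (norm_nonneg _)
  refine (norm_sum_le _ _).trans ?_
  have hr : 0 ≤ r := (norm_nonneg a).trans ha
  calc ∑ i ∈ Finset.range n, ‖a ^ i * b ^ (n - 1 - i)‖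
      ≤ ∑ i ∈ Finset.range n, r ^ (n - 1) := by
        refine Finset.sum_le_sum fun i hi ↦ ?_
        have : n - 1 = i + (n - 1 - i) := by have := Finset.mem_range.1 hi; omega
        rw [norm_mul, norm_pow, norm_pow]
        conv_rhs => rw [this, pow_add]
        gcongr
    _ = n * r ^ (n - 1) := by simp

/-- The Fourier–Laplace multiplier `(e^{wε} - 1) / (ε w²)` at `w = β + it`. -/
noncomputable def smoothedKernel (β ε t : ℝ) : ℂ :=
  (Complex.exp ((β + t * Complex.I) * ε) - 1) / (ε * (β + t * Complex.I) ^ 2)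

lemma norm_sq_add_mul_I (β t : ℝ) : ‖(β + t * Complex.I : ℂ)‖ ^ 2 = β ^ 2 + t ^ 2 := by
  rw [← Complex.normSq_eq_norm_sq, Complex.normSq_add_mul_I]

lemma add_mul_I_ne_zero {β : ℝ} (hβ : 0 < β) (t : ℝ) : (β + t * Complex.I : ℂ) ≠ 0 := by
  intro h
  have := congrArg Complex.re h
  simp at this
  exact hβ.ne' this

lemma le_norm_add_mul_I {β : ℝ} (hβ : 0 < β) (t : ℝ) : β ≤ ‖(β + t * Complex.I : ℂ)‖ := by
  have := Complex.abs_re_le_norm (β + t * Complex.I : ℂ)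
  simpa [abs_of_pos hβ] using this

lemma norm_smoothedKernel_le {β ε : ℝ} (hβ : 0 < β) (hε : |ε| ≤ 1) (hε0 : ε ≠ 0) (t : ℝ) :
    ‖smoothedKernel β ε t‖ ≤ (Real.exp β + 1) / |ε| * (β ^ 2 + t ^ 2)⁻¹ := by
  unfold smoothedKernel
  rw [norm_div, norm_mul, norm_pow, norm_sq_add_mul_I, Complex.norm_real, Real.norm_eq_abs,
    div_mul_eq_mul_div, ← div_eq_mul_inv, div_div, mul_comm |ε|]
  gcongr
  refine (norm_sub_le _ _).trans ?_
  rw [Complex.norm_exp, norm_one]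
  gcongr
  have : ((β + t * Complex.I : ℂ) * ε).re = β * ε := by simp
  rw [this]
  nlinarith [le_abs_self ε]

lemma norm_smoothedKernel_sub_le {β ε : ℝ} (hβ : 0 < β) (hε : |ε| ≤ 1) (hε0 : ε ≠ 0)
    {t : ℝ} (ht : |t| ≤ 1) :
    ‖smoothedKernel β ε t - (β : ℂ)⁻¹‖ ≤ |ε| * Real.exp (β + 1) + |t| * (β ^ 2)⁻¹ := by
  set w : ℂ := β + t * Complex.I with hw
  have hw0 : w ≠ 0 := add_mul_I_ne_zero hβ t
  have hβw : β ≤ ‖w‖ := le_norm_add_mul_I hβ t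
  have hwle : ‖w‖ ≤ β + 1 := by
    refine (norm_add_le _ _).trans ?_
    simp [abs_of_pos hβ, ht]
  have hεC : (ε : ℂ) ≠ 0 := by exact_mod_cast hε0
  have hβC : (β : ℂ) ≠ 0 := by exact_mod_cast hβ.ne'
  have h1 : smoothedKernel β ε t - (β : ℂ)⁻¹ =
      (Complex.exp (w * ε) - 1 - w * ε) / (ε * w ^ 2) + (-(t * Complex.I)) / (β * w) := by
    have : (t * Complex.I : ℂ) = w - β := by rw [hw]; ring
    rw [this]
    unfold smoothedKernel
    rw [← hw]
    field_simp
    ring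
  rw [h1]
  refine (norm_add_le _ _).trans (add_le_add ?_ ?_)
  · have := Complex.norm_exp_sub_sum_le_norm_mul_exp (w * ε) 2
    simp only [Finset.sum_range_succ, Finset.sum_range_zero, Nat.factorial] at this
    norm_num at this
    rw [← sub_sub] at this
    rw [norm_div, norm_mul, norm_pow, Complex.norm_real, Real.norm_eq_abs, div_le_iff₀ (by positivity)]
    refine this.trans ?_
    have : ‖w‖ * |ε| ≤ β + 1 := by nlinarith [abs_nonneg ε, norm_nonneg w]
    calc (‖w‖ * |ε|) ^ 2 * Real.exp (‖w‖ * |ε|) ≤ (‖w‖ * |ε|) ^ 2 * Real.exp (β + 1) := by gcongr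
      _ = _ := by ring
  · rw [norm_div, norm_neg, norm_mul, norm_mul, Complex.norm_real, Complex.norm_real,
      Complex.norm_I, mul_one, Real.norm_eq_abs, Real.norm_eq_abs, abs_of_pos hβ, div_eq_mul_inv,
      sq]
    gcongr

lemma abs_one_sub_sub_exp_neg_le {u : ℝ} (h0 : 0 ≤ u) (h1 : u ≤ 1) :
    |1 - u - Real.exp (-u)| ≤ u ^ 2 := by
  have := Real.abs_exp_sub_one_sub_id_le (x := -u) (by rwa [abs_neg, abs_of_nonneg h0])
  rw [abs_sub_comm]
  rw [neg_sq] at this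
  convert this using 2
  ring

/-- Near the origin, powers of a characteristic function are close to Gaussians. -/
lemma exists_norm_pow_sub_gaussian_le {φ : ℝ → ℂ} {σ C₀ : ℝ} (hσ : 0 < σ)
    (hφ : ∀ t, ‖φ t - (1 - σ ^ 2 * t ^ 2 / 2 : ℝ)‖ ≤ C₀ * |t| ^ 3) :
    ∃ δ > 0, δ ≤ 1 ∧ ∃ C₁ ≥ 0, ∀ t, |t| ≤ δ → ∀ n : ℕ, 1 ≤ n →
      ‖φ t ^ n‖ ≤ Real.exp (-(σ ^ 2 / 4) * (n * t ^ 2)) ∧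
      ‖φ t ^ n - (Real.exp (-(σ ^ 2 / 2) * (n * t ^ 2)) : ℝ)‖ ≤
        C₁ * (n * |t| ^ 3) * Real.exp (-(σ ^ 2 / 4) * (n * t ^ 2)) := by
  have hC₀ : 0 ≤ C₀ := by simpa using (norm_nonneg _).trans (hφ 1)
  set δ : ℝ := min 1 (min (σ ^ 2 / (4 * (C₀ + 1))) (1 / σ)) with hδ
  have hδ0 : 0 < δ := by positivity
  have hδ1 : δ ≤ 1 := min_le_left _ _
  have hδ2 : C₀ * δ ≤ σ ^ 2 / 4 := by
    have : δ ≤ σ ^ 2 / (4 * (C₀ + 1)) := (min_le_right _ _).trans (min_le_left _ _)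
    rw [le_div_iff₀ (by positivity)] at this
    nlinarith
  have hδ3 : σ * δ ≤ 1 := by
    have : δ ≤ 1 / σ := (min_le_right _ _).trans (min_le_right _ _)
    rw [le_div_iff₀ hσ] at this
    linarith
  refine ⟨δ, hδ0, hδ1, (C₀ + σ ^ 4) * Real.exp (σ ^ 2 / 4), by positivity, fun t ht n hn ↦ ?_⟩
  have hta := abs_nonneg t
  have ht2 : |t| ^ 2 = t ^ 2 := sq_abs t
  have hu1 : σ ^ 2 * t ^ 2 / 2 ≤ 1 := by
    have : σ * |t| ≤ 1 := (mul_le_mul_of_nonneg_left ht hσ.le).trans hδ3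
    have h2 : (σ * |t|) ^ 2 ≤ 1 := pow_le_one₀ (by positivity) this
    rw [mul_pow, ht2] at h2
    linarith
  have hcube : C₀ * |t| ^ 3 ≤ σ ^ 2 / 4 * t ^ 2 := by
    calc C₀ * |t| ^ 3 = C₀ * |t| * |t| ^ 2 := by ring
      _ ≤ C₀ * δ * |t| ^ 2 := by gcongr
      _ ≤ σ ^ 2 / 4 * |t| ^ 2 := by gcongr
      _ = _ := by rw [ht2]
  have hnorm : ‖φ t‖ ≤ Real.exp (-(σ ^ 2 / 4) * t ^ 2) := by
    have h1 : ‖φ t‖ ≤ ‖φ t - (1 - σ ^ 2 * t ^ 2 / 2 : ℝ)‖ + ‖((1 - σ ^ 2 * t ^ 2 / 2 : ℝ) : ℂ)‖ :=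
      norm_le_norm_sub_add _ _
    rw [Complex.norm_real, Real.norm_eq_abs, abs_of_nonneg (by linarith)] at h1
    have h2 := Real.add_one_le_exp (-(σ ^ 2 / 4) * t ^ 2)
    linarith [hφ t]
  have hexp : ‖((Real.exp (-(σ ^ 2 / 2) * t ^ 2) : ℝ) : ℂ)‖ ≤ Real.exp (-(σ ^ 2 / 4) * t ^ 2) := by
    rw [Complex.norm_real, Real.norm_eq_abs, Real.abs_exp]
    gcongr
    linarith
  have hdiff : ‖φ t - (Real.exp (-(σ ^ 2 / 2) * t ^ 2) : ℝ)‖ ≤ (C₀ + σ ^ 4) * |t| ^ 3 := by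
    have h1 := norm_sub_le_norm_sub_add_norm_sub (φ t) ((1 - σ ^ 2 * t ^ 2 / 2 : ℝ) : ℂ)
      ((Real.exp (-(σ ^ 2 / 2) * t ^ 2) : ℝ) : ℂ)
    rw [← Complex.ofReal_sub, Complex.norm_real, Real.norm_eq_abs] at h1
    have h2 := abs_one_sub_sub_exp_neg_le (u := σ ^ 2 * t ^ 2 / 2) (by positivity) hu1
    have h3 : -(σ ^ 2 / 2) * t ^ 2 = -(σ ^ 2 * t ^ 2 / 2) := by ring
    have h4 : (σ ^ 2 * t ^ 2 / 2) ^ 2 ≤ σ ^ 4 * |t| ^ 3 := by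
      have : (σ ^ 2 * t ^ 2 / 2) ^ 2 = σ ^ 4 * |t| ^ 3 * (|t| / 4) := by
        rw [← ht2]; ring
      rw [this]
      exact mul_le_of_le_one_right (by positivity) (by linarith)
    rw [h3] at h1 ⊢
    linarith [hφ t]
  have hpow : ∀ c : ℝ, ∀ m : ℕ, Real.exp (-c * t ^ 2) ^ m = Real.exp (-c * (m * t ^ 2)) := by
    intro c m
    rw [← Real.exp_nat_mul]
    ring_nf
  constructor
  · rw [norm_pow, ← hpow]
    gcongr
  · have h1 := norm_pow_sub_pow_le hnorm hexp n
    rw [← Complex.ofReal_pow, hpow, hpow] at h1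
    refine h1.trans ?_
    have h2 : Real.exp (-(σ ^ 2 / 4) * (((n - 1 : ℕ) : ℝ) * t ^ 2)) ≤
        Real.exp (σ ^ 2 / 4) * Real.exp (-(σ ^ 2 / 4) * (n * t ^ 2)) := by
      rw [← Real.exp_add]
      gcongr
      rw [Nat.cast_sub hn]
      have : t ^ 2 ≤ 1 := by rw [← ht2]; exact pow_le_one₀ hta (ht.trans hδ1)
      push_cast
      nlinarith [sq_nonneg σ]
    calc (n : ℝ) * Real.exp (-(σ ^ 2 / 4) * (((n - 1 : ℕ) : ℝ) * t ^ 2)) *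
          ‖φ t - (Real.exp (-(σ ^ 2 / 2) * t ^ 2) : ℝ)‖
        ≤ n * (Real.exp (σ ^ 2 / 4) * Real.exp (-(σ ^ 2 / 4) * (n * t ^ 2))) *
          ((C₀ + σ ^ 4) * |t| ^ 3) := by gcongr
      _ = _ := by ring

lemma exists_nat_mul_sqrt_mul_pow_le {ρ : ℝ} (h0 : 0 ≤ ρ) (h1 : ρ < 1) :
    ∃ K : ℝ, 0 ≤ K ∧ ∀ n : ℕ, 1 ≤ n → ρ ^ n * √n ≤ K / n := by
  obtain ⟨K, hK⟩ := (tendsto_pow_const_mul_const_pow_of_lt_one 2 h0 h1).bddAbove_range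
  have hK' : ∀ n : ℕ, (n : ℝ) ^ 2 * ρ ^ n ≤ K := fun n ↦ hK ⟨n, rfl⟩
  refine ⟨K, le_trans (by positivity) (hK' 0), fun n hn ↦ ?_⟩
  have hn' : (1 : ℝ) ≤ n := by exact_mod_cast hn
  rw [le_div_iff₀ (by positivity)]
  have : √(n : ℝ) ≤ n := Real.sqrt_le_iff.2 ⟨by positivity, by nlinarith⟩
  calc ρ ^ n * √n * n ≤ ρ ^ n * n * n := by gcongr
    _ = (n : ℝ) ^ 2 * ρ ^ n := by ring
    _ ≤ K := hK' n

lemma integrable_inv_sq_add_sq {β : ℝ} (hβ : 0 < β) :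
    Integrable fun t : ℝ ↦ (β ^ 2 + t ^ 2)⁻¹ := by
  have := (integrable_inv_one_add_sq.comp_div hβ.ne').const_mul (β ^ 2)⁻¹
  refine this.congr (.of_forall fun t ↦ ?_)
  simp only
  rw [← mul_inv]
  congr 1
  field_simp

lemma continuous_smoothedKernel {β ε : ℝ} (hβ : 0 < β) (hε0 : ε ≠ 0) :
    Continuous (smoothedKernel β ε) := by
  unfold smoothedKernel
  refine Continuous.div (by fun_prop) (by fun_prop) fun t ↦ ?_
  have := add_mul_I_ne_zero hβ t
  have : (ε : ℂ) ≠ 0 := by exact_mod_cast hε0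
  positivity

/-- A local limit theorem for the smoothed kernel, with error `O(1/n)`. -/
theorem exists_norm_integral_pow_mul_smoothedKernel_sub_le {φ : ℝ → ℂ} {σ β C₀ : ℝ}
    (hσ : 0 < σ) (hβ : 0 < β) (hcont : Continuous φ)
    (hφ : ∀ t, ‖φ t - (1 - σ ^ 2 * t ^ 2 / 2 : ℝ)‖ ≤ C₀ * |t| ^ 3)
    (hgap : ∀ δ > 0, ∃ ρ < 1, ∀ t, δ ≤ |t| → ‖φ t‖ ≤ ρ) :
    ∃ C, ∀ n : ℕ, 1 ≤ n → ∀ ε : ℝ, |ε| = 1 / √n →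
      ‖(∫ t, φ t ^ n * smoothedKernel β ε t) - (√(2 * π / (n * σ ^ 2)) / β : ℝ)‖ ≤ C / n := by
  obtain ⟨δ, hδ0, hδ1, C₁, hC₁, hnear⟩ := exists_norm_pow_sub_gaussian_le hσ hφ
  obtain ⟨ρ, hρ1, hρ⟩ := hgap δ hδ0
  have hρ0 : 0 ≤ ρ := (norm_nonneg _).trans (hρ δ (le_abs_self δ))
  obtain ⟨K, hK0, hK⟩ := exists_nat_mul_sqrt_mul_pow_le hρ0 hρ1
  set c : ℝ := σ ^ 2 / 4 with hc
  have hc0 : 0 < c := by positivity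
  set G : ℝ → ℝ := fun s ↦ (1 + |s| + |s| ^ 3) * Real.exp (-c * s ^ 2) with hG
  have hGi : Integrable G := integrable_one_add_abs_add_cube_mul_exp hc0
  have hLi := integrable_inv_sq_add_sq hβ
  set A : ℝ := Real.exp (β + 1) + (β ^ 2)⁻¹ + β⁻¹ * C₁ + β⁻¹ * δ⁻¹ with hA
  set B : ℝ := Real.exp β + 1
  refine ⟨A * (∫ s, G s) + B * K * ∫ t, (β ^ 2 + t ^ 2)⁻¹, fun n hn ε hε ↦ ?_⟩
  have hn1 : (1 : ℝ) ≤ n := by exact_mod_cast hn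
  have hn0 : (0 : ℝ) < n := by linarith
  set r : ℝ := √n with hr
  have hr1 : 1 ≤ r := Real.one_le_sqrt.2 hn1
  have hr0 : 0 < r := by linarith
  have hrr : r ^ 2 = n := Real.sq_sqrt hn0.le
  have hε1 : |ε| ≤ 1 := by rw [hε, div_le_one hr0]; exact hr1
  have hε0 : ε ≠ 0 := by
    rw [← abs_pos, hε]; positivity
  have hgauss : (∫ t : ℝ, ((β⁻¹ * Real.exp (-(n * σ ^ 2 / 2) * t ^ 2) : ℝ) : ℂ)) =
      (√(2 * π / (n * σ ^ 2)) / β : ℝ) := by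
    rw [integral_complex_ofReal, integral_const_mul, integral_gaussian]
    congr 1
    rw [mul_comm, div_eq_mul_inv]
    congr 2
    field_simp
  have hgaussi : Integrable fun t : ℝ ↦ ((β⁻¹ * Real.exp (-(n * σ ^ 2 / 2) * t ^ 2) : ℝ) : ℂ) :=
    ((integrable_exp_neg_mul_sq (by positivity)).const_mul _).ofReal
  set bound : ℝ → ℝ := fun t ↦ A / r * G (r * t) + B * (ρ ^ n * r) * (β ^ 2 + t ^ 2)⁻¹ with hbound
  have hboundi : Integrable bound :=
    ((hGi.comp_mul_left' hr0.ne').const_mul _).add (hLi.const_mul _)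
  have hpt : ∀ t, ‖φ t ^ n * smoothedKernel β ε t -
      ((β⁻¹ * Real.exp (-(n * σ ^ 2 / 2) * t ^ 2) : ℝ) : ℂ)‖ ≤ bound t := by
    intro t
    have hGe : A / r * G (r * t) =
        A * (1 / r + |t| + n * |t| ^ 3) * Real.exp (-c * (n * t ^ 2)) := by
      simp only [hG, abs_mul, abs_of_pos hr0, mul_pow, hrr]
      rw [show r ^ 3 = n * r by rw [← hrr]; ring]
      field_simp
    have hE := Real.exp_pos (-c * (n * t ^ 2))
    set E := Real.exp (-c * (n * t ^ 2))
    have hge : Real.exp (-(n * σ ^ 2 / 2) * t ^ 2) ≤ E := by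
      apply Real.exp_le_exp.2
      rw [hc]
      nlinarith [mul_nonneg hn0.le (mul_nonneg (sq_nonneg σ) (sq_nonneg t))]
    have hta := abs_nonneg t
    simp only [hbound, hGe]
    rcases le_total |t| δ with ht | ht
    · obtain ⟨h1, h2⟩ := hnear t ht n hn
      have h3 := norm_smoothedKernel_sub_le hβ hε1 hε0 (ht.trans hδ1)
      have h4 : φ t ^ n * smoothedKernel β ε t -
          ((β⁻¹ * Real.exp (-(n * σ ^ 2 / 2) * t ^ 2) : ℝ) : ℂ) =
          φ t ^ n * (smoothedKernel β ε t - (β : ℂ)⁻¹) +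
          (β : ℂ)⁻¹ * (φ t ^ n - (Real.exp (-(σ ^ 2 / 2) * (n * t ^ 2)) : ℝ)) := by
        rw [show -(n * σ ^ 2 / 2) * t ^ 2 = -(σ ^ 2 / 2) * (n * t ^ 2) by ring]
        push_cast
        ring
      rw [h4]
      refine (norm_add_le _ _).trans ?_
      rw [norm_mul, norm_mul, norm_inv, Complex.norm_real, Real.norm_eq_abs, abs_of_pos hβ]
      have h5 : 0 ≤ B * (ρ ^ n * r) * (β ^ 2 + t ^ 2)⁻¹ := by positivity
      rw [hε] at h3
      calc ‖φ t ^ n‖ * ‖smoothedKernel β ε t - (β : ℂ)⁻¹‖ +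
            β⁻¹ * ‖φ t ^ n - (Real.exp (-(σ ^ 2 / 2) * (n * t ^ 2)) : ℝ)‖
          ≤ E * (1 / r * Real.exp (β + 1) + |t| * (β ^ 2)⁻¹) +
            β⁻¹ * (C₁ * (n * |t| ^ 3) * E) := by gcongr
        _ = (Real.exp (β + 1) * (1 / r) + (β ^ 2)⁻¹ * |t| + β⁻¹ * C₁ * (n * |t| ^ 3)) * E := by
            ring
        _ ≤ (A * (1 / r) + A * |t| + A * (n * |t| ^ 3)) * E := by
            have p1 : 0 < Real.exp (β + 1) := Real.exp_pos _
            have p2 : 0 < (β ^ 2)⁻¹ := by positivity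
            have p3 : 0 ≤ β⁻¹ * C₁ := by positivity
            have p4 : 0 < β⁻¹ * δ⁻¹ := by positivity
            gcongr <;> linarith
        _ = A * (1 / r + |t| + n * |t| ^ 3) * E := by ring
        _ ≤ _ := le_add_of_nonneg_right h5
    · refine (norm_sub_le _ _).trans ?_
      rw [add_comm, norm_mul, norm_pow, Complex.norm_real, Real.norm_eq_abs, abs_mul, Real.abs_exp,
        abs_of_pos (inv_pos.2 hβ)]
      refine add_le_add ?_ ?_
      · have h1 : 1 ≤ δ⁻¹ * |t| := by
          rw [inv_mul_eq_div, le_div_iff₀ hδ0]; linarith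
        calc β⁻¹ * Real.exp (-(n * σ ^ 2 / 2) * t ^ 2) ≤ β⁻¹ * E := by gcongr
          _ ≤ β⁻¹ * (δ⁻¹ * |t|) * E := by
            gcongr
            exact le_mul_of_one_le_right (by positivity) h1
          _ = (β⁻¹ * δ⁻¹) * |t| * E := by ring
          _ ≤ A * (1 / r + |t| + n * |t| ^ 3) * E := by
            have p1 : 0 < Real.exp (β + 1) := Real.exp_pos _
            have p2 : 0 < (β ^ 2)⁻¹ := by positivity
            have p3 : 0 ≤ β⁻¹ * C₁ := by positivity
            have p5 : 0 ≤ n * |t| ^ 3 := by positivity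
            have p6 : 0 < 1 / r := by positivity
            gcongr <;> linarith
      · have h1 := norm_smoothedKernel_le hβ hε1 hε0 t
        rw [hε, div_div_eq_mul_div, div_one] at h1
        calc ‖φ t‖ ^ n * ‖smoothedKernel β ε t‖ ≤ ρ ^ n * (B * r * (β ^ 2 + t ^ 2)⁻¹) := by
              gcongr
              exact hρ t ht
          _ = _ := by ring
  have hmeas : AEStronglyMeasurable (fun t ↦ φ t ^ n * smoothedKernel β ε t) volume :=
    ((hcont.pow n).mul (continuous_smoothedKernel hβ hε0)).aestronglyMeasurable
  have hdi : Integrable fun t ↦ φ t ^ n * smoothedKernel β ε t -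
      ((β⁻¹ * Real.exp (-(n * σ ^ 2 / 2) * t ^ 2) : ℝ) : ℂ) :=
    hboundi.mono' (hmeas.sub hgaussi.aestronglyMeasurable) (.of_forall hpt)
  have hfi : Integrable fun t ↦ φ t ^ n * smoothedKernel β ε t := by
    exact (hdi.add hgaussi).congr (.of_forall fun t ↦ sub_add_cancel _ _)
  rw [← hgauss, ← integral_sub hfi hgaussi]
  refine (norm_integral_le_of_norm_le hboundi (.of_forall hpt)).trans ?_
  rw [hbound, integral_add ((hGi.comp_mul_left' hr0.ne').const_mul _) (hLi.const_mul _),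
    integral_const_mul, integral_const_mul, Measure.integral_comp_mul_left,
    abs_of_pos (inv_pos.2 hr0), smul_eq_mul, add_div _ _ (n : ℝ)]
  refine add_le_add (le_of_eq ?_) ?_
  · rw [← hrr]; field_simp
  · have hI : 0 ≤ ∫ t : ℝ, (β ^ 2 + t ^ 2)⁻¹ := integral_nonneg fun t ↦ by positivity
    calc B * (ρ ^ n * r) * ∫ t : ℝ, (β ^ 2 + t ^ 2)⁻¹
        ≤ B * (K / n) * ∫ t : ℝ, (β ^ 2 + t ^ 2)⁻¹ := by gcongr; exact hK n hn
      _ = _ := by ring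

lemma integrableOn_mul_exp_neg_mul {β : ℝ} (hβ : 0 < β) :
    IntegrableOn (fun s : ℝ ↦ s * Real.exp (-β * s)) (Set.Ioi 0) := by
  simpa using integrableOn_rpow_mul_exp_neg_mul_rpow (p := 1) (s := 1) (by norm_num) one_pos hβ

/-- The Laplace transform of `s ↦ s` on the half-plane `Re w > 0`. -/
lemma integral_Ioi_mul_cexp_neg_mul {w : ℂ} (hw : 0 < w.re) :
    ∫ s in Set.Ioi (0 : ℝ), (s : ℂ) * Complex.exp (-w * s) = 1 / w ^ 2 := by
  have hw0 : w ≠ 0 := by rintro rfl; simp at hw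
  have hnorm : ∀ s : ℝ, ‖Complex.exp (-w * s)‖ = Real.exp (-w.re * s) := fun s ↦ by
    simp [Complex.norm_exp]
  have hderiv : ∀ s ∈ Set.Ici (0 : ℝ), HasDerivAt
      (fun s : ℝ ↦ -((s : ℂ) / w + 1 / w ^ 2) * Complex.exp (-w * s))
      ((s : ℂ) * Complex.exp (-w * s)) s := fun s _ ↦ by
    have h1 : HasDerivAt (fun s : ℝ ↦ (s : ℂ)) 1 s := Complex.ofRealCLM.hasDerivAt
    have h2 := (((h1.div_const w).add_const (1 / w ^ 2)).neg).mul ((h1.const_mul (-w)).cexp)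
    refine h2.congr_deriv ?_
    simp only [Pi.neg_apply]
    field_simp
    ring
  have hInt : IntegrableOn (fun s : ℝ ↦ (s : ℂ) * Complex.exp (-w * s)) (Set.Ioi 0) := by
    refine (integrableOn_mul_exp_neg_mul hw).mono' (by fun_prop) ?_
    filter_upwards [ae_restrict_mem measurableSet_Ioi] with s hs
    rw [norm_mul, hnorm, Complex.norm_real, Real.norm_of_nonneg (le_of_lt hs)]
  have hlim : Tendsto (fun s : ℝ ↦ -((s : ℂ) / w + 1 / w ^ 2) * Complex.exp (-w * s)) atTop
      (nhds 0) := by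
    have e0 : Tendsto (fun s : ℝ ↦ Complex.exp (-w * s)) atTop (nhds 0) := by
      rw [tendsto_zero_iff_norm_tendsto_zero]
      simp_rw [hnorm]
      simpa using tendsto_rpow_mul_exp_neg_mul_atTop_nhds_zero 0 w.re hw
    have e1 : Tendsto (fun s : ℝ ↦ (s : ℂ) * Complex.exp (-w * s)) atTop (nhds 0) := by
      rw [tendsto_zero_iff_norm_tendsto_zero]
      have := (tendsto_rpow_mul_exp_neg_mul_atTop_nhds_zero 1 w.re hw).abs
      simp only [Real.rpow_one, abs_mul, Real.abs_exp, abs_zero] at this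
      simpa only [norm_mul, hnorm, Complex.norm_real, Real.norm_eq_abs] using this
    have := (e1.const_mul (-(1 / w))).sub (e0.const_mul (1 / w ^ 2))
    simp only [mul_zero, sub_zero] at this
    refine this.congr fun s ↦ ?_
    ring
  rw [integral_Ioi_of_hasDerivAt_of_tendsto' hderiv hInt hlim]
  simp

/-- Laplace inversion for the positive part. -/
lemma integral_cexp_div_sq_eq_max {β : ℝ} (hβ : 0 < β) (y : ℝ) :
    ∫ t : ℝ, Complex.exp ((β + t * Complex.I) * y) / (β + t * Complex.I) ^ 2 =
      2 * π * (max y 0 : ℝ) := by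
  set h : ℝ → ℂ := fun s ↦ ((max s 0 * Real.exp (-β * s) : ℝ) : ℂ) with hh
  have hcont : Continuous h := by fun_prop
  have hInt : Integrable h := by
    suffices Integrable fun s : ℝ ↦ max s 0 * Real.exp (-β * s) from this.ofReal
    have h1 : (fun s : ℝ ↦ max s 0 * Real.exp (-β * s)) =
        (Set.Ioi 0).indicator fun s ↦ s * Real.exp (-β * s) := by
      ext s
      by_cases hs : 0 < s
      · simp [hs, hs.le]
      · simp [hs, not_lt.1 hs]
    rw [h1, integrable_indicator_iff measurableSet_Ioi]
    exact integrableOn_mul_exp_neg_mul hβ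
  have hF : FourierTransform.fourier h = fun ξ : ℝ ↦ 1 / (β + (2 * π * ξ : ℝ) * Complex.I) ^ 2 := by
    ext ξ
    rw [Real.fourier_real_eq_integral_exp_smul,
      ← integral_Ioi_mul_cexp_neg_mul (w := β + (2 * π * ξ : ℝ) * Complex.I) (by simpa using hβ),
      ← setIntegral_eq_integral_of_forall_compl_eq_zero (s := Set.Ioi 0)]
    · refine setIntegral_congr_fun measurableSet_Ioi fun s hs ↦ ?_
      have hs' : 0 < s := hs
      simp only [hh, max_eq_left hs'.le, smul_eq_mul]
      push_cast
      rw [mul_left_comm, ← Complex.exp_add]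
      ring_nf
    · intro s hs
      have hs' : s ≤ 0 := not_lt.1 hs
      simp [hh, max_eq_right hs']
  have hnormF : ∀ t : ℝ, ‖1 / (β + t * Complex.I : ℂ) ^ 2‖ = (β ^ 2 + t ^ 2)⁻¹ := fun t ↦ by
    rw [norm_div, norm_pow, norm_sq_add_mul_I, norm_one, one_div]
  have hFint : Integrable (FourierTransform.fourier h) := by
    rw [hF]
    have : Integrable fun t : ℝ ↦ 1 / (β + t * Complex.I : ℂ) ^ 2 := by
      refine (integrable_inv_sq_add_sq hβ).mono' ?_ (.of_forall fun t ↦ (hnormF t).le)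
      refine Continuous.aestronglyMeasurable (Continuous.div (by fun_prop) (by fun_prop) fun t ↦ ?_)
      exact pow_ne_zero 2 (add_mul_I_ne_zero hβ t)
    exact this.comp_mul_left' (by positivity : (2 * π : ℝ) ≠ 0)
  have hinv := congrFun (hcont.fourierInv_fourier_eq hInt hFint) y
  rw [Real.fourierInv_eq', hF] at hinv
  have hscale := Measure.integral_comp_mul_left
    (fun t : ℝ ↦ Complex.exp ((β + t * Complex.I) * y) / (β + t * Complex.I) ^ 2) (2 * π)
  rw [abs_of_pos (by positivity), Complex.real_smul] at hscale
  have hπ : ((2 * π : ℝ) : ℂ) ≠ 0 := by exact_mod_cast (by positivity : (2 * π : ℝ) ≠ 0)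
  have key : ∫ x : ℝ, Complex.exp ((β + (2 * π * x : ℝ) * Complex.I) * y) /
      (β + (2 * π * x : ℝ) * Complex.I) ^ 2 = (max y 0 : ℝ) := by
    have : ((max y 0 : ℝ) : ℂ) = Complex.exp (β * y) * h y := by
      simp only [hh]
      push_cast
      rw [mul_left_comm, ← Complex.exp_add]
      simp
    rw [this, ← hinv, ← integral_const_mul]
    congr 1
    ext t
    rw [smul_eq_mul, mul_one_div, mul_div_assoc', ← Complex.exp_add]
    congr 2
    simp
    ring
  rw [key] at hscale
  rw [hscale, show (2 * π : ℂ) = (2 * π : ℝ) by push_cast; rfl, Complex.ofReal_inv,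
    mul_inv_cancel_left₀ hπ]

lemma integrable_smoothedKernel {β ε : ℝ} (hβ : 0 < β) (hε : |ε| ≤ 1) (hε0 : ε ≠ 0) :
    Integrable (smoothedKernel β ε) :=
  ((integrable_inv_sq_add_sq hβ).const_mul _).mono'
    (continuous_smoothedKernel hβ hε0).aestronglyMeasurable
    (.of_forall (norm_smoothedKernel_le hβ hε hε0))

lemma norm_cexp_add_mul_I_mul (β t y : ℝ) :
    ‖Complex.exp ((β + t * Complex.I) * y)‖ = Real.exp (β * y) := by
  simp [Complex.norm_exp]

/-- A difference quotient of the positive part as a Laplace inversion integral. -/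
lemma integral_cexp_mul_smoothedKernel {β ε : ℝ} (hβ : 0 < β) (y : ℝ) :
    ∫ t : ℝ, Complex.exp ((β + t * Complex.I) * y) * smoothedKernel β ε t =
      2 * π * ((max (y + ε) 0 - max y 0) / ε : ℝ) := by
  have hInt : ∀ z : ℝ, Integrable fun t : ℝ ↦
      Complex.exp ((β + t * Complex.I) * z) / (β + t * Complex.I) ^ 2 := fun z ↦ by
    refine ((integrable_inv_sq_add_sq hβ).const_mul (Real.exp (β * z))).mono' ?_
      (.of_forall fun t ↦ ?_)
    · refine Continuous.aestronglyMeasurable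
        (Continuous.div (by fun_prop) (by fun_prop) fun t ↦ ?_)
      exact pow_ne_zero 2 (add_mul_I_ne_zero hβ t)
    · rw [norm_div, norm_cexp_add_mul_I_mul, norm_pow, norm_sq_add_mul_I, div_eq_mul_inv]
  have h1 : ∀ t : ℝ, Complex.exp ((β + t * Complex.I) * y) * smoothedKernel β ε t =
      (Complex.exp ((β + t * Complex.I) * (y + ε : ℝ)) / (β + t * Complex.I) ^ 2 -
        Complex.exp ((β + t * Complex.I) * y) / (β + t * Complex.I) ^ 2) / ε := fun t ↦ by
    unfold smoothedKernel
    rw [Complex.ofReal_add, mul_add, Complex.exp_add, ← sub_div, div_div, ← mul_div_assoc]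
    ring
  simp_rw [h1]
  rw [integral_div, integral_sub (hInt _) (hInt _), integral_cexp_div_sq_eq_max hβ,
    integral_cexp_div_sq_eq_max hβ]
  push_cast
  ring

/-- The smoothed volume of the sublevel set of a sum as a Laplace inversion integral. -/
lemma integral_smoothed_sublevel {V : ℝ → ℝ} (hV : Measurable V) {β ε R : ℝ} (hβ : 0 < β)
    (hε : |ε| ≤ 1) (hε0 : ε ≠ 0) (hInt : Integrable fun x ↦ Real.exp (-β * V x)) (n : ℕ) :
    Integrable (fun x : Fin n → ℝ ↦
      (max (n * R - ∑ i, V (x i) + ε) 0 - max (n * R - ∑ i, V (x i)) 0) / ε) ∧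
    2 * π * ((∫ x : Fin n → ℝ,
      (max (n * R - ∑ i, V (x i) + ε) 0 - max (n * R - ∑ i, V (x i)) 0) / ε : ℝ) : ℂ) =
      ∫ t : ℝ, (∫ x, Complex.exp ((β + t * Complex.I) * (R - V x : ℝ))) ^ n *
        smoothedKernel β ε t := by
  set D : (Fin n → ℝ) → ℝ := fun x ↦
    (max (n * R - ∑ i, V (x i) + ε) 0 - max (n * R - ∑ i, V (x i)) 0) / ε with hD
  set Φ : (Fin n → ℝ) → ℝ → ℂ := fun x t ↦
    (∏ i, Complex.exp ((β + t * Complex.I) * (R - V (x i) : ℝ))) * smoothedKernel β ε t with hΦ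
  have hΦi : Integrable (Function.uncurry Φ) (volume.prod volume) := by
    have h1 : Integrable fun x ↦ Real.exp (β * (R - V x)) := by
      refine (hInt.const_mul (Real.exp (β * R))).congr (.of_forall fun x ↦ ?_)
      simp only [← Real.exp_add]
      ring_nf
    have h2 : Integrable fun x : Fin n → ℝ ↦ ∏ i, Real.exp (β * (R - V (x i))) :=
      Integrable.fintype_prod fun _ ↦ h1
    have h3 := h2.mul_prod (integrable_smoothedKernel hβ hε hε0).norm
    refine h3.mono' (Measurable.aestronglyMeasurable ?_) (.of_forall fun z ↦ ?_)
    · have := (continuous_smoothedKernel hβ hε0).measurable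
      simp only [hΦ, Function.uncurry_def]
      fun_prop
    · simp only [hΦ, Function.uncurry_def, norm_mul, norm_prod, norm_cexp_add_mul_I_mul]
      rfl
  have hinner : ∀ x, ∫ t, Φ x t = 2 * π * (D x : ℂ) := fun x ↦ by
    rw [hD, ← integral_cexp_mul_smoothedKernel hβ]
    congr 1
    ext t
    simp only [hΦ]
    rw [← Complex.exp_sum, ← Finset.mul_sum]
    congr 3
    push_cast
    simp
  constructor
  · have h1 := hΦi.integral_prod_left
    simp only [Function.uncurry_apply_pair, hinner] at h1
    have h2 := (h1.const_mul ((2 * π : ℂ)⁻¹)).re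
    refine h2.congr (.of_forall fun x ↦ ?_)
    have hπ : (2 * π : ℂ) ≠ 0 := by exact_mod_cast (by positivity : (2 * π : ℝ) ≠ 0)
    beta_reduce
    rw [← mul_assoc, inv_mul_cancel₀ hπ, one_mul]
    simp
  · change 2 * π * ((∫ x, D x : ℝ) : ℂ) = _
    rw [← integral_complex_ofReal, ← integral_const_mul]
    simp_rw [← hinner]
    rw [integral_integral_swap hΦi]
    congr 1
    ext t
    simp only [hΦ]
    rw [integral_mul_const, integral_fintype_prod_volume_eq_pow
      (fun x ↦ Complex.exp ((β + t * Complex.I) * (R - V x : ℝ)))]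
    simp

/-- The volume of a sublevel set lies between its two smoothed versions. -/
lemma volume_sublevel_mem_Icc {V : ℝ → ℝ} (hV : Measurable V) {R ε : ℝ} (hε0 : 0 < ε) {n : ℕ}
    (h₁ : Integrable (fun x : Fin n → ℝ ↦
      (max (n * R - ∑ i, V (x i) + ε) 0 - max (n * R - ∑ i, V (x i)) 0) / ε))
    (h₂ : Integrable (fun x : Fin n → ℝ ↦
      (max (n * R - ∑ i, V (x i) + -ε) 0 - max (n * R - ∑ i, V (x i)) 0) / -ε)) :
    (volume {x : Fin n → ℝ | ∑ i, V (x i) ≤ n * R}).toReal ∈ Set.Icc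
      (∫ x : Fin n → ℝ,
        (max (n * R - ∑ i, V (x i) + -ε) 0 - max (n * R - ∑ i, V (x i)) 0) / -ε)
      (∫ x : Fin n → ℝ,
        (max (n * R - ∑ i, V (x i) + ε) 0 - max (n * R - ∑ i, V (x i)) 0) / ε) := by
  set B : Set (Fin n → ℝ) := {x | ∑ i, V (x i) ≤ n * R} with hB
  have hBm : MeasurableSet B := measurableSet_le (by fun_prop) measurable_const
  have hvol : (volume B).toReal = ∫ x, B.indicator (fun _ ↦ (1 : ℝ)) x := by
    rw [integral_indicator hBm]; simp [Measure.real]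
  have hup : ∀ x, B.indicator (fun _ ↦ (1 : ℝ)) x ≤
      (max (n * R - ∑ i, V (x i) + ε) 0 - max (n * R - ∑ i, V (x i)) 0) / ε := fun x ↦ by
    rw [le_div_iff₀ hε0]
    by_cases hx : x ∈ B
    · have hx' : ∑ i, V (x i) ≤ n * R := hx
      rw [Set.indicator_of_mem hx, max_eq_left (by linarith), max_eq_left (by linarith)]
      linarith
    · rw [Set.indicator_of_notMem hx, zero_mul, sub_nonneg]
      gcongr
      linarith
  have hlow : ∀ x, (max (n * R - ∑ i, V (x i) + -ε) 0 - max (n * R - ∑ i, V (x i)) 0) / -ε ≤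
      B.indicator (fun _ ↦ (1 : ℝ)) x := fun x ↦ by
    rw [div_neg, ← neg_div, neg_sub, div_le_iff₀ hε0]
    by_cases hx : x ∈ B
    · have hx' : ∑ i, V (x i) ≤ n * R := hx
      rw [Set.indicator_of_mem hx, max_eq_left (a := _ - _) (by linarith)]
      linarith [le_max_left (n * R - ∑ i, V (x i) + -ε) 0]
    · have hx' : n * R < ∑ i, V (x i) := not_le.1 hx
      rw [Set.indicator_of_notMem hx, max_eq_right (by linarith), max_eq_right (by linarith)]
      simp
  have hind : Integrable (B.indicator fun _ ↦ (1 : ℝ)) := by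
    refine h₁.mono' (measurable_const.indicator hBm).aestronglyMeasurable (.of_forall fun x ↦ ?_)
    rw [Real.norm_of_nonneg (Set.indicator_nonneg (fun _ _ ↦ zero_le_one) x)]
    exact hup x
  rw [hvol]
  exact ⟨integral_mono h₂ hind hlow, integral_mono hind h₁ hup⟩

lemma norm_cexp_neg_mul_I_sub_le (x : ℝ) :
    ‖Complex.exp (-(x : ℂ) * Complex.I) - (1 - x * Complex.I - x ^ 2 / 2)‖ ≤ 4 * |x| ^ 3 := by
  have hI : Complex.exp (-(x : ℂ) * Complex.I) - (1 - x * Complex.I - x ^ 2 / 2) =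
      Complex.exp (-(x : ℂ) * Complex.I) -
        ∑ m ∈ Finset.range 3, (-(x : ℂ) * Complex.I) ^ m / m.factorial := by
    simp only [Finset.sum_range_succ, Finset.sum_range_zero, Nat.factorial, mul_pow, Complex.I_sq]
    push_cast
    ring
  have hn : ‖-(x : ℂ) * Complex.I‖ = |x| := by simp
  have hx := abs_nonneg x
  rcases le_total |x| 1 with h | h
  · rw [hI]
    refine (Complex.norm_exp_sub_sum_le_norm_mul_exp _ 3).trans ?_
    rw [hn, mul_comm]
    gcongr
    calc Real.exp |x| ≤ Real.exp 1 := by gcongr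
      _ ≤ 4 := by linarith [Real.exp_one_lt_d9]
  · refine (norm_sub_le _ _).trans ?_
    have h1 : ‖Complex.exp (-(x : ℂ) * Complex.I)‖ = 1 := by simp [Complex.norm_exp]
    have h2 : ‖(1 - x * Complex.I - x ^ 2 / 2 : ℂ)‖ ≤ 1 + |x| + |x| ^ 2 / 2 := by
      refine (norm_sub_le _ _).trans (add_le_add ((norm_sub_le _ _).trans ?_) ?_) <;> simp
    have h3 : |x| ≤ |x| ^ 3 := le_self_pow₀ h (by norm_num)
    have h4 : |x| ^ 2 ≤ |x| ^ 3 := pow_le_pow_right₀ h (by norm_num)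
    have h5 : 1 ≤ |x| ^ 3 := one_le_pow₀ h
    linarith

section CharacteristicFunction

variable {Ω : Type*} [MeasurableSpace Ω] {μ : Measure Ω} [IsProbabilityMeasure μ] {Y : Ω → ℝ}

lemma norm_cexp_neg_mul_I (x : ℝ) : ‖Complex.exp (-(x : ℂ) * Complex.I)‖ = 1 := by
  simp [Complex.norm_exp]

lemma integrable_cexp_neg_mul_I (hY : Measurable Y) (t : ℝ) :
    Integrable (fun ω ↦ Complex.exp (-(t * Y ω : ℝ) * Complex.I)) μ :=
  (integrable_const (1 : ℝ)).mono' (Measurable.aestronglyMeasurable (by fun_prop))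
    (.of_forall fun _ ↦ (norm_cexp_neg_mul_I _).le)

lemma continuous_integral_cexp_neg_mul_I (hY : Measurable Y) :
    Continuous fun t : ℝ ↦ ∫ ω, Complex.exp (-(t * Y ω : ℝ) * Complex.I) ∂μ :=
  continuous_of_dominated (bound := fun _ ↦ 1)
    (fun t ↦ (integrable_cexp_neg_mul_I hY t).aestronglyMeasurable)
    (fun _ ↦ .of_forall fun _ ↦ (norm_cexp_neg_mul_I _).le) (integrable_const _)
    (.of_forall fun _ ↦ by fun_prop)

/-- Second-order expansion of the characteristic function of a centred variable. -/
lemma norm_integral_cexp_sub_le (hY : Measurable Y) (h1 : Integrable Y μ)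
    (h2 : Integrable (fun ω ↦ Y ω ^ 2) μ) (h3 : Integrable (fun ω ↦ |Y ω| ^ 3) μ) {σ : ℝ}
    (hmean : ∫ ω, Y ω ∂μ = 0) (hvar : ∫ ω, Y ω ^ 2 ∂μ = σ ^ 2) (t : ℝ) :
    ‖(∫ ω, Complex.exp (-(t * Y ω : ℝ) * Complex.I) ∂μ) - (1 - σ ^ 2 * t ^ 2 / 2 : ℝ)‖ ≤
      4 * (∫ ω, |Y ω| ^ 3 ∂μ) * |t| ^ 3 := by
  have hq1 : Integrable (fun ω ↦ (1 : ℂ) - (t * Y ω : ℝ) * Complex.I) μ :=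
    (integrable_const _).sub ((h1.const_mul t).ofReal.mul_const _)
  have hq2 : Integrable (fun ω ↦ (((t * Y ω) ^ 2 / 2 : ℝ) : ℂ)) μ := by
    have h : Integrable (fun ω ↦ (t * Y ω) ^ 2 / 2) μ :=
      (h2.const_mul (t ^ 2 / 2)).congr (.of_forall fun ω ↦ by ring)
    exact h.ofReal
  have hquad : ∫ ω, ((1 : ℂ) - (t * Y ω : ℝ) * Complex.I - ((t * Y ω) ^ 2 / 2 : ℝ)) ∂μ =
      (1 - σ ^ 2 * t ^ 2 / 2 : ℝ) := by
    rw [integral_sub hq1 hq2, integral_sub (integrable_const _)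
      ((h1.const_mul t).ofReal.mul_const _), integral_mul_const, integral_complex_ofReal,
      integral_const_mul, hmean, integral_complex_ofReal]
    have : ∫ ω, (t * Y ω) ^ 2 / 2 ∂μ = σ ^ 2 * t ^ 2 / 2 := by
      rw [← hvar, ← integral_mul_const, ← integral_div]
      congr 1
      ext ω
      ring
    rw [this]
    simp
  have hq : Integrable
      (fun ω ↦ (1 : ℂ) - (t * Y ω : ℝ) * Complex.I - ((t * Y ω) ^ 2 / 2 : ℝ)) μ := hq1.sub hq2
  rw [← hquad, ← integral_sub (integrable_cexp_neg_mul_I hY t) hq,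
    mul_right_comm, ← integral_const_mul]
  refine norm_integral_le_of_norm_le (h3.const_mul _) (.of_forall fun ω ↦ ?_)
  have := norm_cexp_neg_mul_I_sub_le (t * Y ω)
  rw [abs_mul, mul_pow, ← mul_assoc] at this
  simpa using this

/-- If the law of `Y` is absolutely continuous, its characteristic function is bounded away
from one outside every neighbourhood of the origin. -/
lemma exists_norm_integral_cexp_le_lt_one (hY : Measurable Y) (hac : μ.map Y ≪ volume)
    {δ : ℝ} (hδ : 0 < δ) :
    ∃ ρ < 1, ∀ t : ℝ, δ ≤ |t| →
      ‖∫ ω, Complex.exp (-(t * Y ω : ℝ) * Complex.I) ∂μ‖ ≤ ρ := by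
  set φ : ℝ → ℂ := fun t ↦ ∫ ω, Complex.exp (-(t * Y ω : ℝ) * Complex.I) ∂μ with hφ
  have hcont : Continuous φ := continuous_integral_cexp_neg_mul_I hY
  have hprob : IsProbabilityMeasure (μ.map Y) := Measure.isProbabilityMeasure_map hY.aemeasurable
  have hlim : Tendsto φ (cocompact ℝ) (nhds 0) := by
    have h1 := Real.tendsto_integral_exp_smul_cocompact
      (fun v ↦ (((μ.map Y).rnDeriv volume v).toReal : ℂ))
    have h2 : Tendsto (fun t : ℝ ↦ (2 * π)⁻¹ * t) (cocompact ℝ) (cocompact ℝ) :=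
      (Homeomorph.mulLeft₀ ((2 * π)⁻¹ : ℝ) (by positivity)).isClosedEmbedding.tendsto_cocompact
    refine (h1.comp h2).congr fun t ↦ ?_
    have h3 : φ t = ∫ v, Complex.exp (-(t * v : ℝ) * Complex.I) ∂(μ.map Y) := by
      rw [integral_map hY.aemeasurable (Measurable.aestronglyMeasurable (by fun_prop))]
    rw [h3, ← integral_rnDeriv_smul hac]
    simp only [Function.comp_apply]
    congr 1
    ext v
    rw [Circle.smul_def, Real.fourierChar_apply, smul_eq_mul, Complex.real_smul, mul_comm]
    congr 3
    push_cast
    have : (π : ℂ) ≠ 0 := by exact_mod_cast Real.pi_ne_zero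
    field_simp
  have hlt : ∀ t, t ≠ 0 → ‖φ t‖ < 1 := by
    intro t ht
    rcases ae_eq_const_or_norm_integral_lt_of_norm_le_const (μ := μ) (C := 1)
      (f := fun ω ↦ Complex.exp (-(t * Y ω : ℝ) * Complex.I))
      (.of_forall fun _ ↦ (norm_cexp_neg_mul_I _).le) with h | h
    · exfalso
      set z := ⨍ ω, Complex.exp (-(t * Y ω : ℝ) * Complex.I) ∂μ
      set A : Set ℝ := {v | Complex.exp (-(t * v : ℝ) * Complex.I) = z} with hA
      have hAc : A.Countable := by
        rcases A.eq_empty_or_nonempty with h0 | ⟨v₀, hv₀⟩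
        · simp [h0]
        refine (Set.countable_range fun k : ℤ ↦ v₀ - k * (2 * π) / t).mono fun v hv ↦ ?_
        have hv' : Complex.exp (-(t * v : ℝ) * Complex.I) =
          Complex.exp (-(t * v₀ : ℝ) * Complex.I) := hv.trans hv₀.symm
        obtain ⟨k, hk⟩ := Complex.exp_eq_exp_iff_exists_int.1 hv'
        refine ⟨k, ?_⟩
        have hk' : -(t * v) = -(t * v₀) + k * (2 * π) := by
          have := congrArg Complex.im hk
          simpa using this
        simp only
        field_simp
        linarith
      have hAnull : μ.map Y A = 0 := hac (hAc.measure_zero _)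
      have hAe : ∀ᵐ ω ∂μ, Y ω ∈ A := h
      have hAm : MeasurableSet A := hAc.measurableSet
      have h5 : ∀ᵐ v ∂(μ.map Y), v ∈ A := (ae_map_iff hY.aemeasurable hAm).2 hAe
      have h6 : ∀ᵐ v ∂(μ.map Y), v ∉ A := measure_eq_zero_iff_ae_notMem.1 hAnull
      obtain ⟨v, hv, hv'⟩ := (h5.and h6).exists
      exact hv' hv
    · rw [probReal_univ, one_mul] at h
      exact h
  obtain ⟨r, hr⟩ : ∃ r : ℝ, ∀ t, r ≤ |t| → ‖φ t‖ ≤ 1 / 2 := by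
    have h1 : ∀ᶠ t in cocompact ℝ, ‖φ t‖ < 1 / 2 := by
      have := hlim.norm
      rw [norm_zero] at this
      exact this.eventually_lt_const (by norm_num)
    obtain ⟨K, hK, hK'⟩ := mem_cocompact.1 h1
    obtain ⟨r, hr⟩ := hK.isBounded.exists_norm_le
    refine ⟨r + 1, fun t ht ↦ le_of_lt (hK' fun htK ↦ ?_)⟩
    have := hr t htK
    rw [Real.norm_eq_abs] at this
    linarith
  have hcpt : IsCompact {t : ℝ | δ ≤ |t| ∧ |t| ≤ r} := by
    refine Metric.isCompact_of_isClosed_isBounded ?_ ?_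
    · exact (isClosed_le continuous_const continuous_abs).inter
        (isClosed_le continuous_abs continuous_const)
    · exact (Metric.isBounded_closedBall (x := (0 : ℝ)) (r := r)).subset fun t ht ↦ by
        simpa using ht.2
  rcases Set.eq_empty_or_nonempty {t : ℝ | δ ≤ |t| ∧ |t| ≤ r} with h0 | h0
  · refine ⟨1 / 2, by norm_num, fun t ht ↦ ?_⟩
    refine hr t (le_of_lt (not_le.1 fun h ↦ ?_))
    have : t ∈ ({t : ℝ | δ ≤ |t| ∧ |t| ≤ r}) := ⟨ht, h⟩
    rw [h0] at this
    exact this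
  · obtain ⟨t₀, ht₀, hmax⟩ := hcpt.exists_isMaxOn h0 hcont.norm.continuousOn
    have ht₀' : t₀ ≠ 0 := abs_pos.1 (hδ.trans_le ht₀.1)
    refine ⟨max ‖φ t₀‖ (1 / 2), max_lt (hlt _ ht₀') (by norm_num), fun t ht ↦ ?_⟩
    rcases le_total |t| r with h | h
    · exact le_max_of_le_left (hmax ⟨ht, h⟩)
    · exact le_max_of_le_right (hr t h)

end CharacteristicFunction

section Orlicz

variable {V : ℝ → ℝ}

lemma ConvexOn.mul_sub_le_sub_of_nonneg (hV : ConvexOn ℝ Set.univ V) (h0 : V 0 = 0) {a x y : ℝ}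
    (ha : 0 < a) (hax : a ≤ x) (hxy : x ≤ y) : V a / a * (y - x) ≤ V y - V x := by
  rcases hxy.eq_or_lt with rfl | hxy
  · simp
  have h1 : V a / a ≤ V x / x := by
    rcases hax.eq_or_lt with rfl | hax
    · rfl
    have := hV.secant_mono (a := 0) (Set.mem_univ _) (Set.mem_univ a) (Set.mem_univ x)
      ha.ne' (ha.trans hax).ne' hax.le
    simpa [h0] using this
  have h2 := hV.slope_mono_adjacent (Set.mem_univ 0) (Set.mem_univ y) (ha.trans_le hax) hxy
  rw [h0, sub_zero, sub_zero] at h2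
  rw [← le_div_iff₀ (sub_pos.2 hxy)]
  exact h1.trans h2

/-- An even convex function vanishing only at the origin pulls null sets back to null sets. -/
lemma volume_preimage_eq_zero_of_convexOn (hsym : ∀ x, V (-x) = V x)
    (hV : ConvexOn ℝ Set.univ V) (hnonneg : ∀ x, 0 ≤ V x) (hzero : ∀ x, V x = 0 ↔ x = 0)
    {A : Set ℝ} (hA : volume A = 0) : volume (V ⁻¹' A) = 0 := by
  have h0 : V 0 = 0 := (hzero 0).2 rfl
  have hpos : ∀ a, 0 < a → volume (V ⁻¹' A ∩ Set.Ici a) = 0 := by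
    intro a ha
    have hm : 0 < V a / a :=
      div_pos ((hnonneg a).lt_of_ne fun h ↦ ha.ne' ((hzero a).1 h.symm)) ha
    set m := V a / a
    set g : ℝ → ℝ := fun x ↦ V (max x a) + m * (min x a) with hg
    have hmono : ∀ x y, x ≤ y → m * (y - x) ≤ g y - g x := by
      intro x y hxy
      have h1 := hV.mul_sub_le_sub_of_nonneg h0 ha (le_max_right x a) (max_le_max_right a hxy)
      have h2 : y - x = (max y a - max x a) + (min y a - min x a) := by
        linarith [max_add_min x a, max_add_min y a]
      rw [h2, mul_add]
      simp only [hg]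
      change m * _ ≤ _ at h1
      linarith
    have hanti : AntilipschitzWith (m⁻¹).toNNReal g := by
      refine AntilipschitzWith.of_le_mul_dist fun x y ↦ ?_
      rw [Real.coe_toNNReal _ (inv_nonneg.2 hm.le), inv_mul_eq_div, le_div_iff₀ hm]
      rcases le_total x y with h | h
      · rw [dist_comm, dist_comm (g x), Real.dist_eq, Real.dist_eq, abs_of_nonneg (sub_nonneg.2 h)]
        linarith [hmono x y h, le_abs_self (g y - g x)]
      · rw [Real.dist_eq, Real.dist_eq, abs_of_nonneg (sub_nonneg.2 h)]
        linarith [hmono y x h, le_abs_self (g x - g y)]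
    have hshift : volume ((fun x ↦ x - m * a) ⁻¹' A) = 0 := by
      simp_rw [sub_eq_add_neg]
      rw [measure_preimage_add_right, hA]
    have h3 := hanti.hausdorffMeasure_preimage_le zero_le_one ((fun x ↦ x - m * a) ⁻¹' A)
    rw [hausdorffMeasure_real, hshift, mul_zero, nonpos_iff_eq_zero] at h3
    refine measure_mono_null (fun x hx ↦ ?_) h3
    have hx2 : a ≤ x := hx.2
    simp only [Set.mem_preimage, hg, max_eq_left hx2, min_eq_right hx2, add_sub_cancel_right]
    exact hx.1
  have hneg : ∀ a, 0 < a → volume (V ⁻¹' A ∩ Set.Iic (-a)) = 0 := by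
    intro a ha
    rw [← Measure.measure_preimage_neg, ← hpos a ha]
    congr 1
    ext x
    simp [hsym]
  have hcover : V ⁻¹' A ⊆ {0} ∪ ⋃ k : ℕ, (V ⁻¹' A ∩ Set.Ici (1 / (k + 1 : ℝ))) ∪
      (V ⁻¹' A ∩ Set.Iic (-(1 / (k + 1 : ℝ)))) := by
    intro x hx
    rcases eq_or_ne x 0 with rfl | hx0
    · simp
    obtain ⟨k, hk⟩ := exists_nat_one_div_lt (abs_pos.2 hx0)
    refine Or.inr (Set.mem_iUnion.2 ⟨k, ?_⟩)
    rcases lt_abs.1 hk with h | h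
    · exact Or.inl ⟨hx, h.le⟩
    · exact Or.inr ⟨hx, show x ≤ _ by linarith⟩
  refine measure_mono_null hcover (measure_union_null (by simp) (measure_iUnion_null fun k ↦ ?_))
  exact measure_union_null (hpos _ (by positivity)) (hneg _ (by positivity))

lemma integrable_exp_neg_mul_abs {c : ℝ} (hc : 0 < c) :
    Integrable fun x : ℝ ↦ Real.exp (-c * |x|) := by
  rw [← integrableOn_univ, ← Set.Iic_union_Ioi (a := (0 : ℝ))]
  refine IntegrableOn.union ?_ ?_
  · refine (integrableOn_exp_mul_Iic hc 0).congr_fun (fun x hx ↦ ?_) measurableSet_Iic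
    simp [abs_of_nonpos (Set.mem_Iic.1 hx)]
  · refine (integrableOn_exp_mul_Ioi (neg_lt_zero.2 hc) 0).congr_fun (fun x hx ↦ ?_)
      measurableSet_Ioi
    simp [abs_of_pos (Set.mem_Ioi.1 hx)]

lemma integrable_exp_neg_mul_of_convexOn (hsym : ∀ x, V (-x) = V x)
    (hV : ConvexOn ℝ Set.univ V) (hnonneg : ∀ x, 0 ≤ V x) (hzero : ∀ x, V x = 0 ↔ x = 0)
    {β : ℝ} (hβ : 0 < β) : Integrable fun x ↦ Real.exp (-β * V x) := by
  have h0 : V 0 = 0 := (hzero 0).2 rfl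
  have hc : 0 < V 1 := (hnonneg 1).lt_of_ne fun h ↦ one_ne_zero ((hzero 1).1 h.symm)
  have habs : ∀ x, V |x| = V x := fun x ↦ by
    rcases abs_choice x with h | h <;> rw [h]
    exact hsym x
  have hcont : Continuous V := continuousOn_univ.1 (hV.continuousOn isOpen_univ)
  have hlow : ∀ x, V 1 * (|x| - 1) ≤ V x := by
    intro x
    rcases le_total |x| 1 with h | h
    · exact (mul_nonpos_of_nonneg_of_nonpos hc.le (by linarith)).trans (hnonneg x)
    · have := hV.mul_sub_le_sub_of_nonneg h0 one_pos le_rfl h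
      rw [div_one, habs] at this
      linarith
  refine ((integrable_exp_neg_mul_abs (mul_pos hβ hc)).const_mul (Real.exp (β * V 1))).mono'
    (by fun_prop) (.of_forall fun x ↦ ?_)
  rw [Real.norm_eq_abs, Real.abs_exp, ← Real.exp_add]
  gcongr
  nlinarith [mul_le_mul_of_nonneg_left (hlow x) hβ.le]

end Orlicz

lemma integrable_pow_mul_exp_neg_mul_of_convexOn {V : ℝ → ℝ} (hsym : ∀ x, V (-x) = V x)
    (hV : ConvexOn ℝ Set.univ V) (hnonneg : ∀ x, 0 ≤ V x) (hzero : ∀ x, V x = 0 ↔ x = 0)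
    {β : ℝ} (hβ : 0 < β) (k : ℕ) : Integrable fun x ↦ V x ^ k * Real.exp (-β * V x) := by
  have hcont : Continuous V := continuousOn_univ.1 (hV.continuousOn isOpen_univ)
  have hInt := integrable_exp_neg_mul_of_convexOn hsym hV hnonneg hzero (half_pos hβ)
  refine (hInt.const_mul (k.factorial / (β / 2) ^ k)).mono' (by fun_prop)
    (.of_forall fun x ↦ ?_)
  have h1 := Real.pow_div_factorial_le_exp (β / 2 * V x) (by have := hnonneg x; positivity) k
  have h2 : Real.exp (-(β / 2) * V x) = Real.exp (β / 2 * V x) * Real.exp (-β * V x) := by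
    rw [← Real.exp_add]
    congr 1
    ring
  rw [Real.norm_of_nonneg (by have := hnonneg x; positivity), h2, ← mul_assoc]
  gcongr
  rw [mul_pow, div_le_iff₀ (by positivity)] at h1
  rw [div_mul_eq_mul_div, le_div_iff₀ (by positivity)]
  linarith

theorem orlicz_ball_volume_asymptotics
    (V : ℝ → ℝ)
    (hVsym : ∀ x, V (-x) = V x) (hVconv : ConvexOn ℝ Set.univ V)
    (hVnonneg : ∀ x, 0 ≤ V x) (hVzero : ∀ x, V x = 0 ↔ x = 0)
    (S : Set ℝ) (hScount : S.Countable)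
    (hSacc : ∀ x : ℝ, ¬ AccPt x (Filter.principal S))
    (hVC2 : ContDiffOn ℝ 2 V Sᶜ)
    (R : ℝ) (hR : 0 < R)
    (αs : ℝ) (hαs : αs < 0)
    (Z σ : ℝ)
    (hZ : Z = ∫ x, Real.exp (αs * V x))
    (hmean : (∫ x, V x * Real.exp (αs * V x)) / Z = R)
    (hσ : σ ^ 2 = (∫ x, V x * V x * Real.exp (αs * V x)) / Z - R ^ 2)
    (hσpos : 0 < σ) :
    ∃ C : ℝ, ∀ n : ℕ, 1 ≤ n →
      |(volume {x : Fin n → ℝ | ∑ i, V (x i) ≤ n * R}).toReal /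
          (Real.exp (-αs * n * R) * Z ^ n /
            (Real.sqrt (2 * π * n) * σ * |αs|)) - 1| ≤
        C / Real.sqrt n := by
  obtain ⟨β, rfl⟩ : ∃ β, αs = -β := ⟨-αs, by ring⟩
  have hβ : 0 < β := by linarith
  have hcont : Continuous V := continuousOn_univ.1 (hVconv.continuousOn isOpen_univ)
  have hVm : Measurable V := hcont.measurable
  have hInt : Integrable fun x ↦ Real.exp (-β * V x) :=
    integrable_exp_neg_mul_of_convexOn hVsym hVconv hVnonneg hVzero hβ
  have hZpos : 0 < Z := hZ ▸ integral_exp_pos hInt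
  set μ : Measure ℝ := volume.tilted fun x ↦ -β * V x with hμ
  have : IsProbabilityMeasure μ := isProbabilityMeasure_tilted hInt
  have hmom : ∀ k : ℕ, Integrable (fun x ↦ V x ^ k) μ := fun k ↦ by
    rw [hμ, integrable_tilted_iff hInt]
    refine (integrable_pow_mul_exp_neg_mul_of_convexOn hVsym hVconv hVnonneg hVzero hβ k).congr
      (.of_forall fun x ↦ mul_comm _ _)
  have hV1 : Integrable V μ := by simpa using hmom 1
  have hE1 : ∫ x, V x ∂μ = R := by
    rw [hμ, integral_tilted, ← hmean, ← integral_div, ← hZ]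
    congr 1
    ext x
    rw [smul_eq_mul]
    ring
  have hE2 : ∫ x, V x ^ 2 ∂μ = σ ^ 2 + R ^ 2 := by
    rw [hσ, sub_add_cancel, hμ, integral_tilted, ← integral_div, ← hZ]
    congr 1
    ext x
    rw [smul_eq_mul]
    ring
  set Y : ℝ → ℝ := fun x ↦ V x - R with hYdef
  have hYm : Measurable Y := hVm.sub_const R
  have hY1 : Integrable Y μ := hV1.sub (integrable_const R)
  have hYsq : ∀ x, Y x ^ 2 = V x ^ 2 - 2 * R * V x + R ^ 2 := fun x ↦ by
    simp only [hYdef]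
    ring
  have hsub : Integrable (fun x ↦ V x ^ 2 - 2 * R * V x) μ := (hmom 2).sub (hV1.const_mul _)
  have hY2 : Integrable (fun x ↦ Y x ^ 2) μ := by
    simp_rw [hYsq]
    exact hsub.add (integrable_const _)
  have hY3 : Integrable (fun x ↦ |Y x| ^ 3) μ := by
    refine (((hmom 3).add (integrable_const (R ^ 3))).const_mul 4).mono'
      (by fun_prop) (.of_forall fun x ↦ ?_)
    have hx := hVnonneg x
    have h1 : |Y x| ≤ V x + R := by
      rw [abs_le]
      constructor <;> simp only [hYdef] <;> linarith
    rw [Real.norm_of_nonneg (by positivity)]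
    refine (pow_le_pow_left₀ (abs_nonneg _) h1 3).trans ?_
    have := add_pow_le hx hR.le 3
    norm_num at this
    exact this
  have hYmean : ∫ x, Y x ∂μ = 0 := by
    rw [hYdef, integral_sub hV1 (integrable_const R), hE1]
    simp
  have hYvar : ∫ x, Y x ^ 2 ∂μ = σ ^ 2 := by
    simp_rw [hYsq]
    rw [integral_add hsub (integrable_const _), integral_sub (hmom 2) (hV1.const_mul _),
      integral_const_mul, hE1, hE2]
    simp
    ring
  have hac : μ.map Y ≪ volume := by
    refine Measure.AbsolutelyContinuous.mk fun A hA hA0 ↦ ?_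
    rw [Measure.map_apply hYm hA]
    refine tilted_absolutelyContinuous _ _ ?_
    have h1 : Y ⁻¹' A = V ⁻¹' ((fun x ↦ x + -R) ⁻¹' A) := by
      ext x
      simp [hYdef, sub_eq_add_neg]
    rw [h1]
    refine volume_preimage_eq_zero_of_convexOn hVsym hVconv hVnonneg hVzero ?_
    rw [measure_preimage_add_right, hA0]
  set φ : ℝ → ℂ := fun t ↦ ∫ x, Complex.exp (-(t * Y x : ℝ) * Complex.I) ∂μ with hφ
  obtain ⟨C, hC⟩ := exists_norm_integral_pow_mul_smoothedKernel_sub_le hσpos hβ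
    (continuous_integral_cexp_neg_mul_I (μ := μ) hYm)
    (norm_integral_cexp_sub_le hYm hY1 hY2 hY3 hYmean hYvar)
    (fun _ ↦ exists_norm_integral_cexp_le_lt_one hYm hac)
  set M : ℝ := Real.exp (β * R) * Z with hM
  have hMpos : 0 < M := by positivity
  have hφM : ∀ t : ℝ, ∫ x, Complex.exp ((β + t * Complex.I) * (R - V x : ℝ)) = M * φ t := by
    intro t
    rw [hφ, hμ]
    simp only
    rw [integral_tilted, ← integral_const_mul, ← hZ]
    congr 1
    ext x
    rw [Complex.real_smul, hM]
    push_cast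
    have hZ0 : (Z : ℂ) ≠ 0 := by exact_mod_cast hZpos.ne'
    have h1 : Complex.exp ((β + t * Complex.I) * (R - V x)) = Complex.exp (β * R) *
        Complex.exp (-β * V x) * Complex.exp (-(t * Y x) * Complex.I) := by
      rw [← Complex.exp_add, ← Complex.exp_add]
      congr 1
      simp only [hYdef]
      push_cast
      ring
    rw [h1]
    field_simp
  refine ⟨C / (2 * π) * (√(2 * π) * σ * β), fun n hn ↦ ?_⟩
  have hn0 : (0 : ℝ) < n := by exact_mod_cast hn
  have hn1 : (1 : ℝ) ≤ n := by exact_mod_cast hn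
  have hs : 0 < √(n : ℝ) := Real.sqrt_pos.2 hn0
  have hε0 : 0 < 1 / √(n : ℝ) := by positivity
  have hε1 : 1 / √(n : ℝ) ≤ 1 := by
    rw [div_le_one hs]
    exact Real.one_le_sqrt.2 hn1
  have key : ∀ ε : ℝ, |ε| = 1 / √(n : ℝ) →
      Integrable (fun x : Fin n → ℝ ↦
        (max (n * R - ∑ i, V (x i) + ε) 0 - max (n * R - ∑ i, V (x i)) 0) / ε) ∧
      |(∫ x : Fin n → ℝ,
        (max (n * R - ∑ i, V (x i) + ε) 0 - max (n * R - ∑ i, V (x i)) 0) / ε) / M ^ n -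
          √(2 * π / (n * σ ^ 2)) / β / (2 * π)| ≤ C / n / (2 * π) := by
    intro ε hε
    have hεne : ε ≠ 0 := abs_pos.1 (hε ▸ hε0)
    obtain ⟨h1, h2⟩ := integral_smoothed_sublevel (R := R) hVm hβ (hε.le.trans hε1) hεne hInt n
    refine ⟨h1, ?_⟩
    have h3 := hC n hn ε hε
    set D := ∫ x : Fin n → ℝ,
        (max (n * R - ∑ i, V (x i) + ε) 0 - max (n * R - ∑ i, V (x i)) 0) / ε
    simp_rw [hφM, mul_pow, mul_assoc] at h2
    rw [integral_const_mul] at h2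
    have h4 : ∫ t : ℝ, φ t ^ n * smoothedKernel β ε t = ((2 * π * D / M ^ n : ℝ) : ℂ) := by
      have : (M : ℂ) ≠ 0 := by exact_mod_cast hMpos.ne'
      push_cast
      rw [eq_div_iff (pow_ne_zero _ this), mul_comm, ← h2, mul_assoc]
    rw [h4, ← Complex.ofReal_sub, Complex.norm_real, Real.norm_eq_abs] at h3
    have h5 : D / M ^ n - √(2 * π / (n * σ ^ 2)) / β / (2 * π) =
        (2 * π * D / M ^ n - √(2 * π / (n * σ ^ 2)) / β) / (2 * π) := by
      field_simp
    rw [h5, abs_div, abs_of_pos Real.two_pi_pos]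
    gcongr
  obtain ⟨hi₁, hb₁⟩ := key (1 / √(n : ℝ)) (abs_of_pos hε0)
  obtain ⟨hi₂, hb₂⟩ := key (-(1 / √(n : ℝ))) (by rw [abs_neg, abs_of_pos hε0])
  obtain ⟨hlo, hup⟩ := volume_sublevel_mem_Icc hVm hε0 hi₁ hi₂
  set v := (volume {x : Fin n → ℝ | ∑ i, V (x i) ≤ n * R}).toReal
  have hMn : 0 < M ^ n := by positivity
  have hlo' := (div_le_div_iff_of_pos_right hMn).2 hlo
  have hup' := (div_le_div_iff_of_pos_right hMn).2 hup
  have hmain : |v / M ^ n - √(2 * π / (n * σ ^ 2)) / β / (2 * π)| ≤ C / n / (2 * π) := by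
    rw [abs_le] at hb₁ hb₂ ⊢
    constructor <;> linarith [hb₁.1, hb₁.2, hb₂.1, hb₂.2]
  have hexp : Real.exp (- -β * n * R) * Z ^ n = M ^ n := by
    rw [hM, mul_pow, ← Real.exp_nat_mul]
    congr 2
    ring
  have hsqrt : √(2 * π / (n * σ ^ 2)) = √(2 * π) / (√n * σ) := by
    rw [Real.sqrt_div' _ (by positivity), Real.sqrt_mul hn0.le, Real.sqrt_sq hσpos.le]
  have hπ : √(2 * π) ^ 2 = 2 * π := Real.sq_sqrt (by positivity)
  have hnn : √(n : ℝ) ^ 2 = n := Real.sq_sqrt hn0.le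
  have hπpos : 0 < √(2 * π) := by positivity
  have hK : 0 < √(2 * π) * √n * σ * β := by positivity
  rw [hexp, abs_neg, abs_of_pos hβ, Real.sqrt_mul (by positivity)]
  have e1 : v / (M ^ n / (√(2 * π) * √n * σ * β)) - 1 =
      (v / M ^ n - √(2 * π / (n * σ ^ 2)) / β / (2 * π)) * (√(2 * π) * √n * σ * β) := by
    have : √(2 * π / (n * σ ^ 2)) / β / (2 * π) * (√(2 * π) * √n * σ * β) = 1 := by
      rw [hsqrt]
      nth_rewrite 2 [← hπ]
      field_simp
    rw [sub_mul, this]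
    field_simp
  have e2 : C / (2 * π) * (√(2 * π) * σ * β) / √n =
      C / n / (2 * π) * (√(2 * π) * √n * σ * β) := by
    rw [show C / (n : ℝ) = C / √(n : ℝ) ^ 2 by rw [hnn]]
    field_simp
  rw [e1, e2, abs_mul, abs_of_pos hK]
  gcongr
end
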